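/- arXiv:0711.2202 — 7 statements merged into one kernel-verified Lean document; each statement's English description precedes it below -/
import Mathlib

section
/- Let n ≥ 5 be an integer and p > (n+4)/(n−4). Define N₁ = −(n−4)(p−1)+8, N₂ = (n²−4n+8)(p−1)², N₃ = (9n−34)(n−2)(p−1)⁴ + 8(3n−8)(n−6)(p−1)³ + (16n²−288n+832)(p−1)² − 128(n−6)(p−1) + 256, and ν₂ = (N₁ − √(N₂ + 4√N₃))/(2(p−1)). Then ν₂ < 0 and ν₂ + n − 2 − 4/(p−1) < 0. Consequently the vector t = (t₁, t₂, t₃, t₄) with t₁ = 1, t₂ = ν₂ − 4/(p−1), t₃ = (ν₂ − 2 − 4/(p−1))(ν₂ − 4/(p−1)), t₄ = (ν₂ + n − 2 − 4/(p−1))(ν₂ − 2 − 4/(p−1))(ν₂ − 4/(p−1)) satisfies t₁ > 0, t₂ < 0, t₃ > 0 and t₄ < 0. -/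
/-- for an integer `n ≥ 5` and `p > (n+4)/(n−4)`, the eigenvalue
`ν₂ = (N₁ − √(N₂ + 4√N₃))/(2(p−1))` satisfies `ν₂ < 0` and
`ν₂ + n − 2 − 4/(p−1) < 0`; consequently the eigenvector
`t = (1, ν₂ − 4/(p−1), (ν₂−2−4/(p−1))(ν₂−4/(p−1)),
(ν₂+n−2−4/(p−1))(ν₂−2−4/(p−1))(ν₂−4/(p−1)))` has sign pattern `(+,−,+,−)`. -/
theorem statement3 (n : ℕ) (hn : 5 ≤ n) (p : ℝ)
    (hp : ((n : ℝ) + 4) / ((n : ℝ) - 4) < p)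
    (N₁ N₂ N₃ ν₂ : ℝ)
    (hN1 : N₁ = -((n : ℝ) - 4) * (p - 1) + 8)
    (hN2 : N₂ = ((n : ℝ) ^ 2 - 4 * (n : ℝ) + 8) * (p - 1) ^ 2)
    (hN3 : N₃ = (9 * (n : ℝ) - 34) * ((n : ℝ) - 2) * (p - 1) ^ 4
      + 8 * (3 * (n : ℝ) - 8) * ((n : ℝ) - 6) * (p - 1) ^ 3
      + (16 * (n : ℝ) ^ 2 - 288 * (n : ℝ) + 832) * (p - 1) ^ 2
      - 128 * ((n : ℝ) - 6) * (p - 1) + 256)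
    (hν2 : ν₂ = (N₁ - Real.sqrt (N₂ + 4 * Real.sqrt N₃)) / (2 * (p - 1)))
    (t₁ t₂ t₃ t₄ : ℝ)
    (ht1 : t₁ = 1)
    (ht2 : t₂ = ν₂ - 4 / (p - 1))
    (ht3 : t₃ = (ν₂ - 2 - 4 / (p - 1)) * (ν₂ - 4 / (p - 1)))
    (ht4 : t₄ = (ν₂ + (n : ℝ) - 2 - 4 / (p - 1)) * (ν₂ - 2 - 4 / (p - 1))
      * (ν₂ - 4 / (p - 1))) :
    ν₂ < 0 ∧ ν₂ + (n : ℝ) - 2 - 4 / (p - 1) < 0 ∧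
    0 < t₁ ∧ t₂ < 0 ∧ 0 < t₃ ∧ t₄ < 0 := by
  have hn' : (5 : ℝ) ≤ n := by exact_mod_cast hn
  have hn4 : (0 : ℝ) < (n : ℝ) - 4 := by linarith
  rw [div_lt_iff₀ hn4] at hp
  have h8 : 8 < ((n : ℝ) - 4) * (p - 1) := by nlinarith
  have hq : 0 < p - 1 := by
    by_contra! h
    nlinarith
  -- the excess of `N₃` over `((n-2)(p-1)²)²` factors into positive terms
  have hfactor : N₃ - (((n : ℝ) - 2) * (p - 1) ^ 2) ^ 2 =
      8 * p * (p + 1) * (((n : ℝ) - 2) * (p - 1) - 4) * (((n : ℝ) - 4) * (p - 1) - 4) := by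
    rw [hN3]; ring
  have hpos : 0 < 8 * p * (p + 1) * (((n : ℝ) - 2) * (p - 1) - 4) *
      (((n : ℝ) - 4) * (p - 1) - 4) := by
    have h1 : 0 < ((n : ℝ) - 2) * (p - 1) - 4 := by linarith
    have h2 : 0 < ((n : ℝ) - 4) * (p - 1) - 4 := by linarith
    have h3 : 0 < p := by linarith
    positivity
  have hsqrt : ((n : ℝ) - 2) * (p - 1) ^ 2 < √N₃ :=
    Real.lt_sqrt_of_sq_lt (by linarith)
  have hS : (n : ℝ) * (p - 1) < √(N₂ + 4 * √N₃) := by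
    apply Real.lt_sqrt_of_sq_lt
    rw [hN2]
    linarith
  have hd : 0 < 4 / (p - 1) := by positivity
  have hν : ν₂ < 0 := by
    rw [hν2]
    apply div_neg_of_neg_of_pos _ (by linarith)
    have := Real.sqrt_nonneg (N₂ + 4 * √N₃)
    rw [hN1]
    linarith
  have hν' : ν₂ + (n : ℝ) - 2 - 4 / (p - 1) < 0 := by
    have h : ν₂ + (n : ℝ) - 2 - 4 / (p - 1) =
        ((n : ℝ) * (p - 1) - √(N₂ + 4 * √N₃)) / (2 * (p - 1)) := by
      rw [hν2, hN1]
      field_simp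
      ring
    rw [h]
    exact div_neg_of_neg_of_pos (by linarith) (by linarith)
  have h2 : ν₂ - 4 / (p - 1) < 0 := by linarith
  have h3 : ν₂ - 2 - 4 / (p - 1) < 0 := by linarith
  refine ⟨hν, hν', by rw [ht1]; exact one_pos, by rw [ht2]; exact h2, ?_, ?_⟩
  · rw [ht3]
    exact mul_pos_of_neg_of_neg h3 h2
  · rw [ht4]
    exact mul_neg_of_pos_of_neg (mul_pos_of_neg_of_neg hν' h3) h2
end

section
/- Let n ≥ 5 be an integer and p > (n+4)/(n−4). Define N₂ = (n²−4n+8)(p−1)² and N₃ = (9n−34)(n−2)(p−1)⁴ + 8(3n−8)(n−6)(p−1)³ + (16n²−288n+832)(p−1)² − 128(n−6)(p−1) + 256. Then N₂ + 4√N₃ > n²(p−1)². -/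
/-- for an integer `n ≥ 5` and `p > (n+4)/(n−4)`, with
`N₂ = (n²−4n+8)(p−1)²` and `N₃` the quartic discriminant quantity,
one has `N₂ + 4√N₃ > n²(p−1)²`. -/
theorem statement5 (n : ℕ) (hn : 5 ≤ n) (p : ℝ)
    (hp : ((n : ℝ) + 4) / ((n : ℝ) - 4) < p)
    (N₂ N₃ : ℝ)
    (hN2 : N₂ = ((n : ℝ) ^ 2 - 4 * (n : ℝ) + 8) * (p - 1) ^ 2)
    (hN3 : N₃ = (9 * (n : ℝ) - 34) * ((n : ℝ) - 2) * (p - 1) ^ 4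
      + 8 * (3 * (n : ℝ) - 8) * ((n : ℝ) - 6) * (p - 1) ^ 3
      + (16 * (n : ℝ) ^ 2 - 288 * (n : ℝ) + 832) * (p - 1) ^ 2
      - 128 * ((n : ℝ) - 6) * (p - 1) + 256) :
    (n : ℝ) ^ 2 * (p - 1) ^ 2 < N₂ + 4 * Real.sqrt N₃ := by
  have hn' : (5 : ℝ) ≤ n := by exact_mod_cast hn
  rw [div_lt_iff₀ (by linarith)] at hp
  obtain ⟨q, rfl⟩ : ∃ q, p = q + 1 := ⟨p - 1, by ring⟩
  simp only [add_sub_cancel_right] at hN2 hN3 ⊢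
  have h4 : 0 < ((n : ℝ) - 4) * q - 4 := by linarith
  have hq : 0 < q := pos_of_mul_pos_right (by linarith : 0 < ((n : ℝ) - 4) * q) (by linarith)
  have h2 : 0 < ((n : ℝ) - 2) * q - 4 := by linarith
  have hfactor : N₃ - (((n : ℝ) - 2) * q ^ 2) ^ 2
      = 8 * ((q + 1) * (q + 2) * ((((n : ℝ) - 2) * q - 4) * (((n : ℝ) - 4) * q - 4))) := by
    rw [hN3]; ring
  have hpos : 0 < 8 * ((q + 1) * (q + 2) * ((((n : ℝ) - 2) * q - 4) * (((n : ℝ) - 4) * q - 4))) := by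
    positivity
  have hsqrt : ((n : ℝ) - 2) * q ^ 2 < Real.sqrt N₃ := Real.lt_sqrt_of_sq_lt (by linarith)
  rw [hN2]
  linarith
end

section
/- Let n > 4 be an integer and p > (n+4)/(n−4). Then there exist a parameter λ > 0, a constant C > 0, and a function u : (0,1] → ℝ such that: u is four times continuously differentiable on (0,1) and continuously differentiable up to r = 1; u(r) ≥ 0 for all r ∈ (0,1); u satisfies the radial equation u''''(r) + (2(n−1)/r)u'''(r) + ((n−1)(n−3)/r²)u''(r) − ((n−1)(n−3)/r³)u'(r) = λ(1+u(r))^p for all r ∈ (0,1); u(1) = 0 and u'(1) = 0; u(r) ≤ C·r^{−4/(p−1)} for all r ∈ (0,1]; and u is singular, i.e. u is unbounded near r = 0 (for every ε > 0, sup over r ∈ (0,ε) of u(r) = +∞). -/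
open Set
open MeasureTheory Filter Topology
open scoped ENNReal

/-- The inverse of `f ↦ r f' - s f` on functions vanishing fast enough at `0`. -/
noncomputable def eulerInv (s : ℝ) (f : ℝ → ℝ≥0∞) (r : ℝ) : ℝ≥0∞ :=
  ENNReal.ofReal (r ^ s) * ∫⁻ x in Ioo 0 r, ENNReal.ofReal (x ^ (-s - 1)) * f x

lemma eulerInv_mono_on {s r : ℝ} {f g : ℝ → ℝ≥0∞} (h : ∀ x ∈ Ioo 0 r, f x ≤ g x) :
    eulerInv s f r ≤ eulerInv s g r := by
  refine mul_le_mul_right ?_ _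
  exact setLIntegral_mono' measurableSet_Ioo fun x hx => mul_le_mul_right (h x hx) _

lemma eulerInv_mono (s : ℝ) : Monotone (eulerInv s) :=
  fun _ _ h _ => eulerInv_mono_on fun x _ => h x

lemma measurable_eulerInv (s : ℝ) (f : ℝ → ℝ≥0∞) : Measurable (eulerInv s f) := by
  have : Monotone fun r : ℝ => ∫⁻ x in Ioo 0 r, ENNReal.ofReal (x ^ (-s - 1)) * f x :=
    fun a b hab => lintegral_mono_set (Ioo_subset_Ioo_right hab)
  exact (ENNReal.measurable_ofReal.comp (by fun_prop)).mul this.measurable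

lemma eulerInv_le_eulerInv {s a b : ℝ} (hs : 0 ≤ s) (ha : 0 ≤ a) (hab : a ≤ b)
    (f : ℝ → ℝ≥0∞) : eulerInv s f a ≤ eulerInv s f b := by
  unfold eulerInv
  gcongr

lemma setLIntegral_ofReal_rpow {b C r : ℝ} (hb : -1 < b) (hC : 0 ≤ C) (hr : 0 < r) :
    ∫⁻ x in Ioo 0 r, ENNReal.ofReal (C * x ^ b)
      = ENNReal.ofReal (C / (b + 1) * r ^ (b + 1)) := by
  have hi : IntervalIntegrable (fun x : ℝ => C * x ^ b) volume 0 r :=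
    (intervalIntegral.intervalIntegrable_rpow' hb).const_mul C
  have hi' : IntegrableOn (fun x : ℝ => C * x ^ b) (Ioo 0 r) :=
    ((intervalIntegrable_iff_integrableOn_Ioo_of_le hr.le).1 hi)
  rw [← ofReal_integral_eq_lintegral_ofReal hi']
  · rw [← integral_Ioc_eq_integral_Ioo, ← intervalIntegral.integral_of_le hr.le,
      intervalIntegral.integral_const_mul, integral_rpow (Or.inl hb),
      Real.zero_rpow (by linarith)]
    congr 1
    ring
  · filter_upwards [ae_restrict_mem measurableSet_Ioo] with x hx
    have := hx.1
    positivity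

lemma eulerInv_rpow {s b C r : ℝ} (hb : s < b) (hC : 0 ≤ C) (hr : 0 < r) :
    eulerInv s (fun x => ENNReal.ofReal (C * x ^ b)) r
      = ENNReal.ofReal (C / (b - s) * r ^ b) := by
  have : ∫⁻ x in Ioo 0 r, ENNReal.ofReal (x ^ (-s - 1)) * ENNReal.ofReal (C * x ^ b)
      = ∫⁻ x in Ioo 0 r, ENNReal.ofReal (C * x ^ (b - s - 1)) := by
    refine setLIntegral_congr_fun measurableSet_Ioo fun x hx => ?_
    have hx0 := hx.1
    rw [← ENNReal.ofReal_mul (by positivity), mul_left_comm, ← Real.rpow_add hx0]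
    ring_nf
  rw [eulerInv, this, setLIntegral_ofReal_rpow (by linarith) hC hr,
    ← ENNReal.ofReal_mul (by positivity), mul_left_comm, ← Real.rpow_add hr]
  ring_nf

lemma eulerInv_le_rpow {s b C X : ℝ} (hb : s < b) (hC : 0 ≤ C) {f : ℝ → ℝ≥0∞}
    (hf : ∀ x ∈ Ioo 0 X, f x ≤ ENNReal.ofReal (C * x ^ b)) :
    ∀ r ∈ Ioo 0 X, eulerInv s f r ≤ ENNReal.ofReal (C / (b - s) * r ^ b) := fun _ hr =>
  (eulerInv_mono_on fun x hx => hf x ⟨hx.1, hx.2.trans hr.2⟩).trans_eq (eulerInv_rpow hb hC hr.1)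

lemma eulerInv_le_rpow_add_rpow {s b d C E X : ℝ} (hb : s < b) (hd : s < d) (hC : 0 ≤ C)
    (hE : 0 ≤ E) {f : ℝ → ℝ≥0∞}
    (hf : ∀ x ∈ Ioo 0 X, f x ≤ ENNReal.ofReal (C * x ^ b + E * x ^ d)) :
    ∀ r ∈ Ioo 0 X, eulerInv s f r
      ≤ ENNReal.ofReal (C / (b - s) * r ^ b + E / (d - s) * r ^ d) := by
  intro r hr
  have hr0 := hr.1
  have hb' := sub_pos.2 hb
  have hd' := sub_pos.2 hd
  rw [ENNReal.ofReal_add (by positivity) (by positivity), ← eulerInv_rpow hb hC hr.1,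
    ← eulerInv_rpow hd hE hr.1, eulerInv, eulerInv, eulerInv, ← mul_add,
    ← lintegral_add_left (by fun_prop)]
  refine mul_le_mul_right ?_ _
  refine setLIntegral_mono' measurableSet_Ioo fun x hx => ?_
  have hx0 := hx.1
  rw [← mul_add, ← ENNReal.ofReal_add (by positivity) (by positivity)]
  exact mul_le_mul_right (hf x ⟨hx.1, hx.2.trans hr.2⟩) _

lemma rpow_le_eulerInv {s b C : ℝ} (hb : s < b) (hC : 0 ≤ C) {f : ℝ → ℝ≥0∞}
    (hf : ∀ x, 0 < x → ENNReal.ofReal (C * x ^ b) ≤ f x) (r : ℝ) (hr : 0 < r) :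
    ENNReal.ofReal (C / (b - s) * r ^ b) ≤ eulerInv s f r :=
  (eulerInv_rpow hb hC hr).symm.trans_le (eulerInv_mono_on fun x hx => hf x hx.1)

section Regularity

variable {s b C X : ℝ} {f : ℝ → ℝ≥0∞}

lemma intervalIntegrable_of_le_rpow (hb : s < b)
    (hm : Measurable f) (hf : ∀ x ∈ Ioo 0 X, f x ≤ ENNReal.ofReal (C * x ^ b)) {r : ℝ}
    (hr : r ∈ Ioo 0 X) :
    IntervalIntegrable (fun x => x ^ (-s - 1) * (f x).toReal) volume 0 r := by
  have hi : IntervalIntegrable (fun x : ℝ => |C| * x ^ (b - s - 1)) volume 0 r :=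
    (intervalIntegral.intervalIntegrable_rpow' (by linarith)).const_mul _
  refine hi.mono_fun (by measurability) ?_
  filter_upwards [ae_restrict_mem measurableSet_uIoc] with x hx
  rw [uIoc_of_le hr.1.le] at hx
  have hx0 := hx.1
  have h1 : (f x).toReal ≤ |C| * x ^ b := by
    refine ENNReal.toReal_le_of_le_ofReal (by positivity) ((hf x ⟨hx.1, hx.2.trans_lt hr.2⟩).trans ?_)
    gcongr
    exact le_abs_self C
  rw [Real.norm_of_nonneg (by positivity), Real.norm_of_nonneg (by positivity)]
  calc x ^ (-s - 1) * (f x).toReal ≤ x ^ (-s - 1) * (|C| * x ^ b) := by gcongr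
    _ = |C| * x ^ (b - s - 1) := by
      rw [mul_left_comm, ← Real.rpow_add hx0]; ring_nf

lemma toReal_eulerInv
    (hm : Measurable f) (hf : ∀ x ∈ Ioo 0 X, f x ≤ ENNReal.ofReal (C * x ^ b)) {r : ℝ}
    (hr : r ∈ Ioo 0 X) :
    (eulerInv s f r).toReal = r ^ s * ∫ x in (0)..r, x ^ (-s - 1) * (f x).toReal := by
  have hr0 := hr.1
  rw [eulerInv, ENNReal.toReal_mul, ENNReal.toReal_ofReal (by positivity)]
  congr 1
  rw [intervalIntegral.integral_of_le hr0.le, integral_Ioc_eq_integral_Ioo,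
    integral_eq_lintegral_of_nonneg_ae _ (by measurability)]
  · congr 1
    refine setLIntegral_congr_fun measurableSet_Ioo fun x hx => ?_
    have hx0 := hx.1
    rw [ENNReal.ofReal_mul (by positivity), ENNReal.ofReal_toReal]
    exact ne_top_of_le_ne_top ENNReal.ofReal_ne_top (hf x ⟨hx.1, hx.2.trans hr.2⟩)
  · filter_upwards [ae_restrict_mem measurableSet_Ioo] with x hx
    have hx0 := hx.1
    simp only [Pi.zero_apply]
    positivity

lemma continuousOn_toReal_eulerInv (hb : s < b)
    (hm : Measurable f) (hf : ∀ x ∈ Ioo 0 X, f x ≤ ENNReal.ofReal (C * x ^ b)) :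
    ContinuousOn (fun r => (eulerInv s f r).toReal) (Ioo 0 X) := by
  intro r hr
  obtain ⟨y, hry, hyX⟩ := exists_between hr.2
  have hy0 := hr.1.trans hry
  have hc := intervalIntegral.continuousOn_primitive_interval'
    (intervalIntegrable_of_le_rpow hb hm hf ⟨hy0, hyX⟩) left_mem_uIcc
  rw [uIcc_of_le hy0.le] at hc
  have he : (fun r => (eulerInv s f r).toReal) =ᶠ[𝓝 r]
      fun r => r ^ s * ∫ x in (0)..r, x ^ (-s - 1) * (f x).toReal := by
    filter_upwards [isOpen_Ioo.mem_nhds hr] with z hz using toReal_eulerInv hm hf hz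
  exact (((Real.continuousAt_rpow_const r s (Or.inl hr.1.ne')).mul
    (hc.continuousAt (Icc_mem_nhds hr.1 hry))).congr he.symm).continuousWithinAt

lemma hasDerivAt_toReal_eulerInv (hb : s < b)
    (hm : Measurable f) (hf : ∀ x ∈ Ioo 0 X, f x ≤ ENNReal.ofReal (C * x ^ b))
    (hc : ContinuousOn (fun x => (f x).toReal) (Ioo 0 X)) {r : ℝ} (hr : r ∈ Ioo 0 X) :
    HasDerivAt (fun r => (eulerInv s f r).toReal)
      ((s * (eulerInv s f r).toReal + (f r).toReal) / r) r := by
  have hr0 := hr.1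
  have hd := intervalIntegral.integral_hasDerivAt_right
    (intervalIntegrable_of_le_rpow hb hm hf hr)
    (StronglyMeasurable.stronglyMeasurableAtFilter
      (Measurable.stronglyMeasurable (by measurability)))
    ((Real.continuousAt_rpow_const _ _ (Or.inl hr0.ne')).mul
      (hc.continuousAt (isOpen_Ioo.mem_nhds hr)))
  have h := ((Real.hasDerivAt_rpow_const (p := s) (Or.inl hr0.ne')).mul hd)
  have he : (fun r => (eulerInv s f r).toReal) =ᶠ[𝓝 r]
      fun r => r ^ s * ∫ x in (0)..r, x ^ (-s - 1) * (f x).toReal := by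
    filter_upwards [isOpen_Ioo.mem_nhds hr] with y hy using toReal_eulerInv hm hf hy
  refine (h.congr_of_eventuallyEq he).congr_deriv ?_
  rw [toReal_eulerInv hm hf hr, Real.rpow_sub_one hr0.ne', ← mul_assoc, ← Real.rpow_add hr0]
  have : s + (-s - 1) = -1 := by ring
  rw [this, Real.rpow_neg_one]
  field_simp

end Regularity

/-- The radial bilaplacian maps `r ^ x` to `radialSymbol ν x * r ^ (x - 4)` in dimension `ν`. -/
def radialSymbol (ν x : ℝ) : ℝ := x * (x - 2) * (x + ν - 2) * (x + ν - 4)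

lemma radialSymbol_lt {ν x y : ℝ} (hν : 4 < ν) (hx : 2 < x) (hxy : x < y) :
    radialSymbol ν x < radialSymbol ν y := by
  unfold radialSymbol
  have h1 : 0 < x - 2 := by linarith
  have h2 : 0 < x + ν - 2 := by linarith
  have h3 : 0 < x + ν - 4 := by linarith
  have h0 : 0 < x := by linarith
  gcongr

lemma exists_radialSymbol_eq {ν κ : ℝ} (hν : 4 < ν) (hκ : 0 < κ) :
    ∃ x, 2 < x ∧ radialSymbol ν x = κ := by
  have hc : ContinuousOn (radialSymbol ν) (Icc 2 (3 + κ)) := by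
    unfold radialSymbol; fun_prop
  have h2 : radialSymbol ν 2 = 0 := by simp [radialSymbol]
  have h3 : κ ≤ radialSymbol ν (3 + κ) := by
    unfold radialSymbol
    have e1 : 1 * κ ≤ (3 + κ) * (3 + κ - 2) := by nlinarith
    have e2 : 1 * 1 ≤ (3 + κ + ν - 2) * (3 + κ + ν - 4) := by nlinarith
    nlinarith
  obtain ⟨x, hx, hxκ⟩ := intermediate_value_Icc (by linarith) hc
    (show κ ∈ Icc _ _ from ⟨by rw [h2]; exact hκ.le, h3⟩)
  refine ⟨x, lt_of_le_of_ne hx.1 ?_, hxκ⟩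
  rintro rfl
  linarith

/-- The increment of `v ↦ v ^ p` at `A`. -/
noncomputable def rpowIncr (A p w : ℝ) : ℝ := (A + w) ^ p - A ^ p

section Increment

variable {A p : ℝ}

lemma rpowIncr_le (hA : 0 < A) (hp : 1 < p) {v w : ℝ} (hv : 0 ≤ v) (hvw : v ≤ w) :
    rpowIncr A p v ≤ rpowIncr A p w := by
  unfold rpowIncr
  gcongr

lemma rpowIncr_nonneg (hA : 0 < A) (hp : 1 < p) {w : ℝ} (hw : 0 ≤ w) : 0 ≤ rpowIncr A p w := by
  simpa [rpowIncr] using rpowIncr_le hA hp le_rfl hw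

lemma mul_le_rpowIncr (hA : 0 < A) (hp : 1 < p) {w : ℝ} (hw : 0 ≤ w) :
    p * A ^ (p - 1) * w ≤ rpowIncr A p w := by
  have h := one_add_mul_self_le_rpow_one_add (s := w / A) (by linarith [div_nonneg hw hA.le]) hp.le
  have h1 : A + w = A * (1 + w / A) := by field_simp
  rw [rpowIncr, h1, Real.mul_rpow hA.le (by positivity), Real.rpow_sub_one hA.ne']
  have h2 : 0 < A ^ p := by positivity
  have h3 : p * (A ^ p / A) * w = A ^ p * (p * (w / A)) := by ring
  nlinarith

lemma exists_rpowIncr_le (hA : 0 < A) {M : ℝ} (hM : 0 < M) :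
    ∃ C, 0 ≤ C ∧ ∀ w ∈ Icc 0 M, rpowIncr A p w ≤ p * A ^ (p - 1) * w + C * w ^ 2 := by
  have hd : ∀ x ∈ Icc 0 M, HasDerivAt (rpowIncr A p) (p * (A + x) ^ (p - 1)) x := fun x hx => by
    have := hx.1
    have h := (((hasDerivAt_id x).const_add A).rpow_const (p := p)
      (Or.inl (by simp; positivity))).sub_const (A ^ p)
    exact h.congr_deriv (by simp)
  have hcd : ContDiffOn ℝ (1 + 1 : ℕ) (rpowIncr A p) (Icc 0 M) := by
    unfold rpowIncr
    refine ContDiffOn.sub (ContDiffOn.rpow_const_of_ne (by fun_prop) fun x hx => ?_) contDiffOn_const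
    have := hx.1
    positivity
  obtain ⟨C, hC⟩ := exists_taylor_mean_remainder_bound hM.le hcd
  refine ⟨|C|, abs_nonneg C, fun w hw => ?_⟩
  have h := hC w hw
  rw [taylorWithinEval_succ, taylor_within_zero_eval] at h
  have h0 : (0 : ℝ) ∈ Icc 0 M := ⟨le_rfl, hM.le⟩
  rw [iteratedDerivWithin_one,
    (hd 0 h0).hasDerivWithinAt.derivWithin (uniqueDiffOn_Icc hM 0 h0)] at h
  simp [rpowIncr] at h
  have := (abs_le.1 h).2
  have h2 : C * w ^ 2 ≤ |C| * w ^ 2 := by gcongr; exact le_abs_self C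
  simp only [rpowIncr]
  norm_num at this
  linarith

end Increment

/-- The inverse of `r ^ 4 * Δ²` on radial functions in dimension `ν`, conjugated by `r ^ α`. -/
noncomputable def biharmonicInv (ν α : ℝ) (f : ℝ → ℝ≥0∞) : ℝ → ℝ≥0∞ :=
  eulerInv α (eulerInv (α + 2) (eulerInv (α + 2 - ν) (eulerInv (α + 4 - ν) f)))

lemma biharmonicInv_mono (ν α : ℝ) : Monotone (biharmonicInv ν α) := fun _ _ h =>
  eulerInv_mono _ (eulerInv_mono _ (eulerInv_mono _ (eulerInv_mono _ h)))

lemma biharmonicInv_le {ν α b d C E X : ℝ} (hν : 4 < ν) (hb : α + 2 < b) (hd : α + 2 < d)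
    (hC : 0 ≤ C) (hE : 0 ≤ E) {f : ℝ → ℝ≥0∞}
    (hf : ∀ x ∈ Ioo 0 X, f x ≤ ENNReal.ofReal (C * x ^ b + E * x ^ d)) :
    ∀ r ∈ Ioo 0 X, biharmonicInv ν α f r ≤ ENNReal.ofReal
      (C / radialSymbol ν (b - α) * r ^ b + E / radialSymbol ν (d - α) * r ^ d) := by
  intro r hr
  have p1 : 0 < b - (α + 4 - ν) := by linarith
  have p2 : 0 < b - (α + 2 - ν) := by linarith
  have p3 : 0 < b - (α + 2) := by linarith
  have q1 : 0 < d - (α + 4 - ν) := by linarith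
  have q2 : 0 < d - (α + 2 - ν) := by linarith
  have q3 : 0 < d - (α + 2) := by linarith
  have h1 := eulerInv_le_rpow_add_rpow (s := α + 4 - ν) (by linarith) (by linarith) hC hE hf
  have h2 := eulerInv_le_rpow_add_rpow (s := α + 2 - ν) (by linarith) (by linarith)
    (by positivity) (by positivity) h1
  have h3 := eulerInv_le_rpow_add_rpow (s := α + 2) (by linarith) (by linarith)
    (by positivity) (by positivity) h2
  have h4 := eulerInv_le_rpow_add_rpow (s := α) (by linarith) (by linarith)
    (by positivity) (by positivity) h3 r hr
  refine h4.trans_eq ?_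
  simp only [radialSymbol, div_div]
  ring_nf

/-- The cut-off nonlinearity `rpowIncr A p (min x (M * r ^ μ))`. -/
noncomputable def cutoffIncr (A p M μ : ℝ) (w : ℝ → ℝ≥0∞) (r : ℝ) : ℝ≥0∞ :=
  ENNReal.ofReal (rpowIncr A p (min (w r) (ENNReal.ofReal (M * r ^ μ))).toReal)

section Cutoff

variable {A p M μ : ℝ}

lemma cutoffIncr_mono (hA : 0 < A) (hp : 1 < p) : Monotone (cutoffIncr A p M μ) :=
  fun _ _ h r => ENNReal.ofReal_le_ofReal <| rpowIncr_le hA hp ENNReal.toReal_nonneg <|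
    ENNReal.toReal_mono (ne_top_of_le_ne_top ENNReal.ofReal_ne_top (min_le_right _ _))
      (min_le_min_right _ (h r))

lemma measurable_cutoffIncr {w : ℝ → ℝ≥0∞} (hw : Measurable w) :
    Measurable (cutoffIncr A p M μ w) := by
  unfold cutoffIncr rpowIncr
  fun_prop

lemma cutoffIncr_le (hA : 0 < A) (hp : 1 < p) {w : ℝ → ℝ≥0∞} {r y : ℝ} (hy : 0 ≤ y)
    (h : w r ≤ ENNReal.ofReal y) :
    cutoffIncr A p M μ w r ≤ ENNReal.ofReal (rpowIncr A p y) :=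
  ENNReal.ofReal_le_ofReal <| rpowIncr_le hA hp ENNReal.toReal_nonneg <|
    ENNReal.toReal_le_of_le_ofReal hy ((min_le_left _ _).trans h)

lemma cutoffIncr_le_cutoff (hA : 0 < A) (hp : 1 < p) (hM : 0 ≤ M) (w : ℝ → ℝ≥0∞) {r : ℝ}
    (hr : 0 < r) : cutoffIncr A p M μ w r ≤ ENNReal.ofReal (rpowIncr A p (M * r ^ μ)) :=
  ENNReal.ofReal_le_ofReal <| rpowIncr_le hA hp ENNReal.toReal_nonneg <|
    ENNReal.toReal_le_of_le_ofReal (by positivity) (min_le_right _ _)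

lemma mul_le_cutoffIncr (hA : 0 < A) (hp : 1 < p) {c : ℝ} (hc : 0 ≤ c) (hcM : c ≤ M)
    {w : ℝ → ℝ≥0∞} {r : ℝ} (hr : 0 < r) (h : ENNReal.ofReal (c * r ^ μ) ≤ w r) :
    ENNReal.ofReal (p * A ^ (p - 1) * c * r ^ μ) ≤ cutoffIncr A p M μ w r := by
  refine ENNReal.ofReal_le_ofReal ?_
  have h1 : 0 ≤ c * r ^ μ := by positivity
  rw [mul_assoc]
  refine (mul_le_rpowIncr hA hp h1).trans (rpowIncr_le hA hp h1 ?_)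
  rw [← ENNReal.ofReal_le_iff_le_toReal
    (ne_top_of_le_ne_top ENNReal.ofReal_ne_top (min_le_right _ _))]
  exact le_min h (ENNReal.ofReal_le_ofReal (by gcongr))

lemma exists_cutoffIncr_le_rpow (hA : 0 < A) (hp : 1 < p) (hM : 0 < M) (hμ : 0 < μ) {X : ℝ}
    (hX : 0 < X) : ∃ L, 0 ≤ L ∧ ∀ w : ℝ → ℝ≥0∞, ∀ r ∈ Ioo 0 X,
      cutoffIncr A p M μ w r ≤ ENNReal.ofReal (L * r ^ μ) := by
  obtain ⟨C, hC, h⟩ := exists_rpowIncr_le (p := p) hA (M := M * X ^ μ) (by positivity)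
  refine ⟨p * A ^ (p - 1) * M + C * (M * X ^ μ) * M, by positivity, fun w r hr => ?_⟩
  have hr0 := hr.1
  have hle : M * r ^ μ ≤ M * X ^ μ := by have := hr.2.le; gcongr
  refine (cutoffIncr_le_cutoff hA hp hM.le w hr.1).trans (ENNReal.ofReal_le_ofReal ?_)
  refine (h _ ⟨by positivity, hle⟩).trans ?_
  have : C * (M * r ^ μ) ^ 2 ≤ C * ((M * X ^ μ) * (M * r ^ μ)) := by
    rw [sq]; gcongr
  linarith

end Cutoff

lemma rpow_le_biharmonicInv {ν α A p M μ c : ℝ} (hν : 4 < ν) (hA : 0 < A) (hp : 1 < p)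
    (hμ : α + 2 < μ) (hQ : radialSymbol ν (μ - α) = p * A ^ (p - 1)) (hc : 0 ≤ c) (hcM : c ≤ M)
    {w : ℝ → ℝ≥0∞} (hw : ∀ r, 0 < r → ENNReal.ofReal (c * r ^ μ) ≤ w r) (r : ℝ) (hr : 0 < r) :
    ENNReal.ofReal (c * (μ - α) * r ^ μ) ≤ eulerInv (α + 2) (eulerInv (α + 2 - ν)
        (eulerInv (α + 4 - ν) (cutoffIncr A p M μ w))) r ∧
    ENNReal.ofReal (c * r ^ μ) ≤ biharmonicInv ν α (cutoffIncr A p M μ w) r := by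
  have p1 : 0 < μ - (α + 4 - ν) := by linarith
  have p2 : 0 < μ - (α + 2 - ν) := by linarith
  have p3 : 0 < μ - (α + 2) := by linarith
  have p4 : 0 < μ - α := by linarith
  have h0 := fun r (hr : 0 < r) => mul_le_cutoffIncr hA hp hc hcM hr (hw r hr)
  have h1 := rpow_le_eulerInv (s := α + 4 - ν) (by linarith) (by positivity) h0
  have h2 := rpow_le_eulerInv (s := α + 2 - ν) (by linarith) (by positivity) h1
  have h3 := rpow_le_eulerInv (s := α + 2) (by linarith) (by positivity) h2
  have e : p * A ^ (p - 1) * c / (μ - (α + 4 - ν)) / (μ - (α + 2 - ν)) / (μ - (α + 2))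
      = c * (μ - α) := by
    rw [← hQ, radialSymbol, show μ - α - 2 = μ - (α + 2) by ring,
      show μ - α + ν - 2 = μ - (α + 2 - ν) by ring, show μ - α + ν - 4 = μ - (α + 4 - ν) by ring]
    field_simp
  rw [e] at h3
  have h4 := rpow_le_eulerInv (s := α) (by linarith) (by positivity) h3 r hr
  rw [mul_div_cancel_right₀ _ p4.ne'] at h4
  exact ⟨h3 r hr, h4⟩

lemma exists_fixedPoint {ν α A p μ c : ℝ} (hν : 4 < ν) (hα : 0 < α) (hA : 0 < A) (hp : 1 < p)
    (hμ : α + 2 < μ) (hQ : radialSymbol ν (μ - α) = p * A ^ (p - 1)) (hc : 0 < c) :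
    ∃ r₀ ∈ Ioo (0 : ℝ) 1, 2 * c * r₀ ^ μ ≤ 1 ∧ ∀ M, c ≤ M → ∃ w : ℝ → ℝ≥0∞,
      biharmonicInv ν α (cutoffIncr A p M μ w) = w ∧
      (∀ r, 0 < r → ENNReal.ofReal (c * r ^ μ) ≤ w r) ∧
      ∀ r ∈ Ioo 0 r₀, w r ≤ ENNReal.ofReal (2 * c * r ^ μ) := by
  obtain ⟨C, hC, hCq⟩ := exists_rpowIncr_le (p := p) hA one_pos
  have hμ0 : 0 < μ := by linarith
  have hΔ : 0 < radialSymbol ν (2 * μ - α) - radialSymbol ν (μ - α) :=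
    sub_pos.2 (radialSymbol_lt hν (by linarith) (by linarith))
  have hQ0 : 0 < radialSymbol ν (μ - α) := by rw [hQ]; positivity
  obtain ⟨B, hB⟩ : ∃ B, B = 4 * C * c ^ 2 / (radialSymbol ν (2 * μ - α) - radialSymbol ν (μ - α)) :=
    ⟨_, rfl⟩
  have hB0 : 0 ≤ B := by rw [hB]; positivity
  have hBeq : radialSymbol ν (μ - α) * B + 4 * C * c ^ 2 = B * radialSymbol ν (2 * μ - α) := by
    have := div_mul_cancel₀ (4 * C * c ^ 2) hΔ.ne'
    rw [← hB] at this
    linarith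
  have ht : Tendsto (fun r : ℝ => r ^ μ) (𝓝[>] 0) (𝓝 0) := by
    have := (Real.continuousAt_rpow_const 0 μ (Or.inr hμ0.le)).tendsto
    rw [Real.zero_rpow hμ0.ne'] at this
    exact this.mono_left nhdsWithin_le_nhds
  have ht1 : ∀ᶠ r : ℝ in 𝓝[>] 0, 2 * c * r ^ μ < 1 := by
    have := ht.const_mul (2 * c)
    rw [mul_zero] at this
    exact this.eventually_lt_const one_pos
  have ht2 : ∀ᶠ r : ℝ in 𝓝[>] 0, B * r ^ μ < c := by
    have := ht.const_mul B
    rw [mul_zero] at this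
    exact this.eventually_lt_const hc
  obtain ⟨r₀, ⟨h1, h2⟩, hr₀⟩ := ((ht1.and ht2).and (Ioo_mem_nhdsGT one_pos)).exists
  have hr00 := hr₀.1
  have hsmall : ∀ r ∈ Ioo 0 r₀, c * r ^ μ + B * r ^ (2 * μ) ≤ 2 * c * r ^ μ ∧
      2 * c * r ^ μ ≤ 1 := fun r hr => by
    have hr0 := hr.1
    have hle : r ^ μ ≤ r₀ ^ μ := by have := hr.2.le; gcongr
    have h3 : B * r ^ μ ≤ c := (mul_le_mul_of_nonneg_left hle hB0).trans h2.le
    refine ⟨?_, (mul_le_mul_of_nonneg_left hle (by positivity)).trans h1.le⟩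
    rw [two_mul μ, Real.rpow_add hr0]
    have : 0 < r ^ μ := by positivity
    nlinarith
  refine ⟨r₀, hr₀, h1.le, fun M hM => ?_⟩
  have hM0 : 0 < M := hc.trans_le hM
  let F : (ℝ → ℝ≥0∞) →o (ℝ → ℝ≥0∞) :=
    ⟨fun w => biharmonicInv ν α (cutoffIncr A p M μ w),
      (biharmonicInv_mono ν α).comp (cutoffIncr_mono hA hp)⟩
  classical
  let lo : ℝ → ℝ≥0∞ := fun r => if 0 < r then ENNReal.ofReal (c * r ^ μ) else 0
  let hi : ℝ → ℝ≥0∞ := fun r =>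
    if r ∈ Ioo 0 r₀ then ENNReal.ofReal (c * r ^ μ + B * r ^ (2 * μ)) else ⊤
  have hlo : lo ≤ F lo := fun r => by
    by_cases hr : 0 < r
    · simp only [lo, if_pos hr]
      exact (rpow_le_biharmonicInv hν hA hp hμ hQ hc.le hM (fun r hr => by simp [hr]) r hr).2
    · simp [lo, hr]
  have hhi : F hi ≤ hi := fun r => by
    by_cases hr : r ∈ Ioo 0 r₀
    · simp only [hi, if_pos hr]
      have hf : ∀ x ∈ Ioo 0 r₀, cutoffIncr A p M μ hi x ≤ ENNReal.ofReal
          (radialSymbol ν (μ - α) * c * x ^ μ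
            + (radialSymbol ν (μ - α) * B + 4 * C * c ^ 2) * x ^ (2 * μ)) := fun x hx => by
        have hx0 := hx.1
        obtain ⟨k1, k2⟩ := hsmall x hx
        have hy : 0 ≤ c * x ^ μ + B * x ^ (2 * μ) := by positivity
        refine (cutoffIncr_le hA hp hy (by simp only [hi, if_pos hx]; exact le_rfl)).trans
          (ENNReal.ofReal_le_ofReal ?_)
        refine (hCq _ ⟨hy, k1.trans k2⟩).trans ?_
        have : C * (c * x ^ μ + B * x ^ (2 * μ)) ^ 2 ≤ C * (2 * c * x ^ μ) ^ 2 := by gcongr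
        have e : (x ^ μ) ^ 2 = x ^ (2 * μ) := by rw [two_mul, Real.rpow_add hx0, sq]
        rw [← hQ]
        rw [mul_pow _ (x ^ μ), e] at this
        linarith
      refine (biharmonicInv_le hν hμ (by linarith) (by positivity) (by positivity) hf r hr).trans_eq ?_
      have : 0 < radialSymbol ν (2 * μ - α) := by linarith
      rw [hBeq, mul_div_cancel_right₀ _ this.ne', mul_div_cancel_left₀ _ hQ0.ne']
    · simp only [hi, if_neg hr, le_top]
  have hlohi : lo ≤ hi := fun r => by
    by_cases hr : r ∈ Ioo 0 r₀
    · have hr0 := hr.1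
      simp only [lo, hi, if_pos hr, if_pos hr.1]
      exact ENNReal.ofReal_le_ofReal (le_add_of_nonneg_right (by positivity))
    · simp only [hi, if_neg hr, le_top]
  refine ⟨F.nextFixed lo hlo, (F.nextFixed lo hlo).2, fun r hr => ?_, fun r hr => ?_⟩
  · simpa [lo, hr] using F.le_nextFixed hlo r
  · have h : ↑(F.nextFixed lo hlo) ≤ hi := OrderHom.lfp_le _ (sup_le hlohi hhi)
    refine (h r).trans ?_
    simp only [hi, if_pos hr]
    exact ENNReal.ofReal_le_ofReal (hsmall r hr).1

lemma HasDerivAt.rpow_neg_mul_add_const {y : ℝ → ℝ} {s z r : ℝ} (hr : 0 < r)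
    (h : HasDerivAt y ((s * y r + z) / r) r) (α k : ℝ) :
    HasDerivAt (fun r => r ^ (-α) * (y r + k))
      ((r ^ (-α) * (z - s * k) + (s - α) * (r ^ (-α) * (y r + k))) / r) r := by
  refine ((Real.hasDerivAt_rpow_const (p := -α) (Or.inl hr.ne')).mul
    (h.add_const k)).congr_deriv ?_
  rw [Real.rpow_sub_one hr.ne']
  field_simp
  ring

/-- A singular radial solution `W` of `Δ² W = W ^ p` up to its first critical point `R`; the radial
equation is written as a first-order system for `W`, `W₁ = r W'`, `W₂ = r W₁' - 2 W₁` and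
`W₃ = r W₂' + (ν - 2) W₂`. -/
lemma exists_singular_profile {ν p α : ℝ} (hν : 4 < ν) (hp : 1 < p) (hα : α = 4 / (p - 1))
    (hαν : α < ν - 4) :
    ∃ (R A L : ℝ) (W W₁ W₂ W₃ : ℝ → ℝ), 0 < R ∧ R ≤ 1 ∧ 0 < A ∧ 0 < L ∧
      (∀ r ∈ Ioo 0 2, HasDerivAt W (W₁ r / r) r) ∧
      (∀ r ∈ Ioo 0 2, HasDerivAt W₁ ((W₂ r + 2 * W₁ r) / r) r) ∧
      (∀ r ∈ Ioo 0 2, HasDerivAt W₂ ((W₃ r - (ν - 2) * W₂ r) / r) r) ∧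
      (∀ r ∈ Ioc 0 R, HasDerivAt W₃ ((r ^ 4 * W r ^ p - (ν - 4) * W₃ r) / r) r) ∧
      W₁ R = 0 ∧ AntitoneOn W (Ioc 0 R) ∧
      ∀ r ∈ Ioc 0 R, A * r ^ (-α) ≤ W r ∧ W r ≤ L * r ^ (-α) := by
  have hp1 : 0 < p - 1 := by linarith
  have hα0 : 0 < α := by rw [hα]; positivity
  have hαp : 4 + -α * p = -α := by rw [hα]; field_simp; ring
  obtain ⟨K, hK⟩ : ∃ K, K = α * (α + 2) * (ν - 2 - α) * (ν - 4 - α) := ⟨_, rfl⟩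
  have hK0 : 0 < K := by
    have h1 : 0 < ν - 2 - α := by linarith
    have h2 : 0 < ν - 4 - α := by linarith
    rw [hK]; positivity
  obtain ⟨A, hA, hAK⟩ : ∃ A, 0 < A ∧ A ^ (p - 1) = K :=
    ⟨K ^ (p - 1)⁻¹, by positivity, Real.rpow_inv_rpow hK0.le hp1.ne'⟩
  have hAp : A ^ p = K * A := by rw [← hAK, Real.rpow_sub_one hA.ne']; field_simp
  obtain ⟨x, hx2, hx⟩ := exists_radialSymbol_eq (ν := ν) (κ := p * A ^ (p - 1)) hν (by positivity)
  obtain ⟨μ, hμx⟩ : ∃ μ, μ = x + α := ⟨_, rfl⟩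
  obtain ⟨c, hc⟩ : ∃ c, c = α * A := ⟨_, rfl⟩
  have hc0 : 0 < c := by rw [hc]; positivity
  have hμ : α + 2 < μ := by linarith
  have hμ0 : 0 < μ := by linarith
  have hQ : radialSymbol ν (μ - α) = p * A ^ (p - 1) := by rw [hμx, add_sub_cancel_right, hx]
  obtain ⟨r₀, hr₀, hcr₀, hfix⟩ := exists_fixedPoint hν hα0 hA hp hμ hQ hc0
  have hr₀0 := hr₀.1
  obtain ⟨M, hM⟩ : ∃ M, M = 2 * c + r₀ ^ (-α) * (A + 1) * r₀ ^ (-μ) := ⟨_, rfl⟩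
  have hMc : 2 * c ≤ M := by rw [hM]; exact le_add_of_nonneg_right (by positivity)
  have hM0 : 0 < M := by linarith
  have hMr₀ : r₀ ^ (-α) * (A + 1) ≤ M * r₀ ^ μ := by
    have e : r₀ ^ (-μ) * r₀ ^ μ = 1 := by rw [← Real.rpow_add hr₀0]; simp
    rw [hM, add_mul, mul_assoc _ (r₀ ^ (-μ)), e, mul_one]
    exact le_add_of_nonneg_left (by positivity)
  obtain ⟨w, hw, hwlo, hwhi⟩ := hfix M (by linarith)
  set φ := cutoffIncr A p M μ w with hφ
  set w₃ := eulerInv (α + 4 - ν) φ with hw₃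
  set w₂ := eulerInv (α + 2 - ν) w₃ with hw₂
  set w₁ := eulerInv (α + 2) w₂ with hw₁
  have hw₀ : eulerInv α w₁ = w := hw
  have hlow := fun r hr =>
    (rpow_le_biharmonicInv (M := M) hν hA hp hμ hQ hc0.le (by linarith) hwlo r hr).1
  rw [← hφ, ← hw₃, ← hw₂, ← hw₁] at hlow
  obtain ⟨L, hL, hLφ⟩ := exists_cutoffIncr_le_rpow hA hp hM0 hμ0 (X := 2) two_pos
  have b1 : 0 < μ - (α + 4 - ν) := by linarith
  have b2 : 0 < μ - (α + 2 - ν) := by linarith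
  have b3 : 0 < μ - (α + 2) := by linarith
  have B4 := hLφ w
  have B3 := eulerInv_le_rpow (sub_pos.1 b1) hL B4
  have B2 := eulerInv_le_rpow (sub_pos.1 b2) (by positivity) B3
  have B1 := eulerInv_le_rpow (sub_pos.1 b3) (by positivity) B2
  have B0 := eulerInv_le_rpow (s := α) (by linarith) (by positivity) B1
  rw [← hφ] at B4 B3 B2 B1 B0
  rw [← hw₃] at B3 B2 B1 B0
  rw [← hw₂] at B2 B1 B0
  rw [← hw₁] at B1 B0
  rw [hw₀] at B0
  have hm0 : Measurable w := hw₀ ▸ measurable_eulerInv _ _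
  have hm1 : Measurable w₁ := measurable_eulerInv _ _
  have hm2 : Measurable w₂ := measurable_eulerInv _ _
  have hm3 : Measurable w₃ := measurable_eulerInv _ _
  have hm4 : Measurable φ := measurable_cutoffIncr hm0
  have C3 := continuousOn_toReal_eulerInv (sub_pos.1 b1) hm4 B4
  have C2 := continuousOn_toReal_eulerInv (sub_pos.1 b2) hm3 B3
  have C1 := continuousOn_toReal_eulerInv (sub_pos.1 b3) hm2 B2
  have C0 := continuousOn_toReal_eulerInv (s := α) (by linarith) hm1 B1
  rw [← hw₃] at C3
  rw [← hw₂] at C2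
  rw [← hw₁] at C1
  rw [hw₀] at C0
  have hfin : ∀ r ∈ Ioo (0 : ℝ) 2, w r ≠ ⊤ :=
    fun r hr => ne_top_of_le_ne_top ENNReal.ofReal_ne_top (B0 r hr)
  have C4 : ContinuousOn (fun r => (φ r).toReal) (Ioo 0 2) := by
    have e : EqOn (fun r => (φ r).toReal)
        (fun r => rpowIncr A p (min (w r).toReal (M * r ^ μ))) (Ioo 0 2) := fun r hr => by
      have hr0 := hr.1
      simp only [hφ, cutoffIncr]
      rw [ENNReal.toReal_ofReal (rpowIncr_nonneg hA hp ENNReal.toReal_nonneg),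
        ENNReal.toReal_min (hfin r hr) ENNReal.ofReal_ne_top,
        ENNReal.toReal_ofReal (by positivity)]
    refine ContinuousOn.congr ?_ e
    have hmin : ContinuousOn (fun r => min (w r).toReal (M * r ^ μ)) (Ioo 0 2) :=
      continuous_min.comp_continuousOn
        (C0.prodMk (continuousOn_const.mul (Real.continuous_rpow_const hμ0.le).continuousOn))
    exact ((continuousOn_const.add hmin).rpow_const fun _ _ => Or.inr (by linarith)).sub
      continuousOn_const
  have D0 := fun r (hr : r ∈ Ioo 0 2) =>
    hasDerivAt_toReal_eulerInv (s := α) (by linarith) hm1 B1 C1 hr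
  have D1 := fun r (hr : r ∈ Ioo 0 2) => hasDerivAt_toReal_eulerInv (sub_pos.1 b3) hm2 B2 C2 hr
  have D2 := fun r (hr : r ∈ Ioo 0 2) => hasDerivAt_toReal_eulerInv (sub_pos.1 b2) hm3 B3 C3 hr
  have D3 := fun r (hr : r ∈ Ioo 0 2) => hasDerivAt_toReal_eulerInv (sub_pos.1 b1) hm4 B4 C4 hr
  rw [← hw₃] at D3
  rw [← hw₂] at D2
  rw [← hw₁] at D1
  rw [hw₀] at D0
  have hmono : ∀ a b, 0 ≤ a → a ≤ b → b < 2 → 0 < b → (w₁ a).toReal ≤ (w₁ b).toReal :=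
    fun a b ha hab hb hb0 => ENNReal.toReal_mono
      (ne_top_of_le_ne_top ENNReal.ofReal_ne_top (B1 b ⟨hb0, hb⟩))
      (eulerInv_le_eulerInv (by linarith) ha hab _)
  obtain ⟨ε, hε, hε1⟩ : ∃ ε ∈ Ioo (0 : ℝ) 1, (w₁ ε).toReal ≤ α * A := by
    obtain ⟨L₁, hL₁, hL₁w⟩ : ∃ L₁, 0 ≤ L₁ ∧ ∀ r ∈ Ioo 0 2, w₁ r ≤ ENNReal.ofReal (L₁ * r ^ μ) :=
      ⟨_, by positivity, B1⟩
    have ht : Tendsto (fun r : ℝ => L₁ * r ^ μ) (𝓝[>] 0) (𝓝 0) := by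
      have := ((Real.continuousAt_rpow_const 0 μ (Or.inr hμ0.le)).const_mul L₁).tendsto
      rw [Real.zero_rpow hμ0.ne', mul_zero] at this
      exact this.mono_left nhdsWithin_le_nhds
    obtain ⟨ε, h1, h2⟩ := ((ht.eventually_lt_const (show 0 < α * A by positivity)).and
      (Ioo_mem_nhdsGT one_pos)).exists
    have := h2.1
    exact ⟨ε, h2, (ENNReal.toReal_le_of_le_ofReal (by positivity)
      (hL₁w ε ⟨h2.1, by linarith [h2.2]⟩)).trans h1.le⟩
  have h1 : α * A ≤ (w₁ 1).toReal := by
    refine le_trans ?_ ((ENNReal.ofReal_le_iff_le_toReal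
      (ne_top_of_le_ne_top ENNReal.ofReal_ne_top (B1 1 (by norm_num)))).1 (hlow 1 one_pos))
    rw [Real.one_rpow, hc]
    nlinarith [mul_pos hα0 hA]
  obtain ⟨R, hR, hRw⟩ := intermediate_value_Icc hε.2.le
    (C1.mono fun r hr => ⟨hε.1.trans_le hr.1, by linarith [hr.2]⟩) ⟨hε1, h1⟩
  have hR0 : 0 < R := hε.1.trans_le hR.1
  have hsub : ∀ r ∈ Ioc 0 R, r ∈ Ioo (0 : ℝ) 2 := fun r hr => ⟨hr.1, by linarith [hr.2, hR.2]⟩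
  set W : ℝ → ℝ := fun r => r ^ (-α) * ((w r).toReal + A) with hW
  set W₁ : ℝ → ℝ := fun r => r ^ (-α) * ((w₁ r).toReal + -α * A) with hW₁
  set W₂ : ℝ → ℝ := fun r => r ^ (-α) * ((w₂ r).toReal + α * (α + 2) * A) with hW₂
  set W₃ : ℝ → ℝ := fun r => r ^ (-α) * ((w₃ r).toReal + α * (α + 2) * (ν - 2 - α) * A) with hW₃
  have E0 : ∀ r ∈ Ioo 0 2, HasDerivAt W (W₁ r / r) r := fun r hr =>
    ((D0 r hr).rpow_neg_mul_add_const hr.1 α A).congr_deriv (by simp only [hW₁]; ring)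
  have E1 : ∀ r ∈ Ioo 0 2, HasDerivAt W₁ ((W₂ r + 2 * W₁ r) / r) r := fun r hr =>
    ((D1 r hr).rpow_neg_mul_add_const hr.1 α (-α * A)).congr_deriv (by simp only [hW₁, hW₂]; ring)
  have E2 : ∀ r ∈ Ioo 0 2, HasDerivAt W₂ ((W₃ r - (ν - 2) * W₂ r) / r) r := fun r hr =>
    ((D2 r hr).rpow_neg_mul_add_const hr.1 α (α * (α + 2) * A)).congr_deriv
      (by simp only [hW₃, hW₂]; ring)
  have hanti : AntitoneOn W (Ioc 0 R) := by
    refine antitoneOn_of_deriv_nonpos (convex_Ioc 0 R)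
      (fun r hr => (E0 r (hsub r hr)).continuousAt.continuousWithinAt)
      (fun r hr => ?_) (fun r hr => ?_)
    · rw [interior_Ioc] at hr
      exact (E0 r (hsub r ⟨hr.1, hr.2.le⟩)).differentiableAt.differentiableWithinAt
    · rw [interior_Ioc] at hr
      rw [(E0 r (hsub r ⟨hr.1, hr.2.le⟩)).deriv]
      have h2 := hmono r R hr.1.le hr.2.le (by linarith [hR.2]) hR0
      have hr0 := hr.1
      refine div_nonpos_of_nonpos_of_nonneg
        (mul_nonpos_of_nonneg_of_nonpos (by positivity) ?_) hr0.le
      linarith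
  have hcut : ∀ r ∈ Ioc 0 R, (w r).toReal ≤ M * r ^ μ := fun r hr => by
    have hr0 := hr.1
    have hsm : ∀ r ∈ Ioo 0 r₀, (w r).toReal ≤ 2 * c * r ^ μ := fun r hr => by
      have := hr.1
      exact ENNReal.toReal_le_of_le_ofReal (by positivity) (hwhi r hr)
    rcases lt_or_ge r r₀ with h | h
    · exact (hsm r ⟨hr.1, h⟩).trans (by gcongr)
    · have hr₀2 : r₀ ∈ Ioo (0 : ℝ) 2 := ⟨hr₀0, by linarith [hr₀.2]⟩
      have hle : (w r₀).toReal ≤ 1 := by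
        have hcw : ContinuousWithinAt (fun r => (w r).toReal) (Iio r₀) r₀ :=
          (C0.continuousAt (isOpen_Ioo.mem_nhds hr₀2)).continuousWithinAt
        refine le_of_tendsto hcw ?_
        filter_upwards [Ioo_mem_nhdsLT hr₀0] with y hy
        have := hy.1
        have h3 : y ^ μ ≤ r₀ ^ μ := by have := hy.2.le; gcongr
        exact (hsm y hy).trans ((mul_le_mul_of_nonneg_left h3 (by positivity)).trans hcr₀)
      have hWW : W r ≤ W r₀ := hanti ⟨hr₀0, h.trans hr.2⟩ hr h
      have hr1 : r ≤ 1 := hr.2.trans hR.2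
      have k1 : 1 ≤ r ^ (-α) :=
        Real.one_le_rpow_of_pos_of_le_one_of_nonpos hr0 hr1 (by linarith)
      have k2 : (w r).toReal ≤ W r := by
        have : 0 ≤ (w r).toReal := ENNReal.toReal_nonneg
        simp only [hW]
        nlinarith
      have k3 : W r₀ ≤ r₀ ^ (-α) * (A + 1) := by
        simp only [hW]
        gcongr _ * ?_
        linarith
      have k4 : M * r₀ ^ μ ≤ M * r ^ μ := by gcongr
      linarith
  refine ⟨R, A, A + M, W, W₁, W₂, W₃, hR0, hR.2, hA, by positivity, E0, E1, E2,
    fun r hr => ?_, ?_, hanti, fun r hr => ⟨?_, ?_⟩⟩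
  · have hr0 := hr.1
    refine ((D3 r (hsub r hr)).rpow_neg_mul_add_const hr.1 α
      (α * (α + 2) * (ν - 2 - α) * A)).congr_deriv ?_
    have hy : 0 ≤ (w r).toReal := ENNReal.toReal_nonneg
    have e1 : (φ r).toReal = (A + (w r).toReal) ^ p - K * A := by
      simp only [hφ, cutoffIncr]
      rw [min_eq_left, ENNReal.toReal_ofReal (rpowIncr_nonneg hA hp hy), rpowIncr, hAp]
      rw [← ENNReal.ofReal_toReal (hfin r (hsub r hr))]
      exact ENNReal.ofReal_le_ofReal (hcut r hr)
    have e2 : r ^ 4 * W r ^ p = r ^ (-α) * (A + (w r).toReal) ^ p := by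
      simp only [hW]
      rw [Real.mul_rpow (by positivity) (by positivity), ← Real.rpow_mul hr0.le, ← mul_assoc,
        ← Real.rpow_natCast, ← Real.rpow_add hr0, add_comm A, Nat.cast_ofNat, hαp]
    rw [e2, e1, hK]
    simp only [hW₃]
    ring
  · simp only at hRw
    simp [hW₁, hRw]
  · have hr0 := hr.1
    rw [mul_comm]
    simp only [hW]
    gcongr _ * ?_
    exact le_add_of_nonneg_left ENNReal.toReal_nonneg
  · have hr0 := hr.1
    rw [mul_comm]
    simp only [hW]
    gcongr _ * ?_
    have k : r ^ μ ≤ 1 := Real.rpow_le_one hr0.le (hr.2.trans hR.2) hμ0.le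
    have := hcut r hr
    nlinarith

section System

variable {ν lam p : ℝ} {u u₁ u₂ u₃ : ℝ → ℝ}

lemma contDiffOn_succ_of_hasDerivAt {s : Set ℝ} (hs : IsOpen s) {k : ℕ} {f f' : ℝ → ℝ}
    (h : ∀ x ∈ s, HasDerivAt f (f' x) x) (hf' : ContDiffOn ℝ k f' s) :
    ContDiffOn ℝ (k + 1 : ℕ) f s := by
  push_cast
  rw [contDiffOn_succ_iff_deriv_of_isOpen hs]
  exact ⟨fun x hx => (h x hx).differentiableAt.differentiableWithinAt, by simp,
    hf'.congr fun x hx => (h x hx).deriv⟩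

lemma contDiffOn_four_of_system {s : Set ℝ} (hs : IsOpen s) (hs0 : ∀ r ∈ s, 0 < r)
    (hu : ∀ r ∈ s, 0 ≤ u r)
    (h : ∀ r ∈ s, HasDerivAt u (u₁ r / r) r)
    (h₁ : ∀ r ∈ s, HasDerivAt u₁ ((u₂ r + 2 * u₁ r) / r) r)
    (h₂ : ∀ r ∈ s, HasDerivAt u₂ ((u₃ r - (ν - 2) * u₂ r) / r) r)
    (h₃ : ∀ r ∈ s, HasDerivAt u₃ ((lam * r ^ 4 * (1 + u r) ^ p - (ν - 4) * u₃ r) / r) r) :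
    ContDiffOn ℝ 4 u s := by
  have hne : ∀ r ∈ s, r ≠ 0 := fun r hr => (hs0 r hr).ne'
  have hc : ContinuousOn u s := fun r hr => (h r hr).continuousAt.continuousWithinAt
  have hc₁ : ContinuousOn u₁ s := fun r hr => (h₁ r hr).continuousAt.continuousWithinAt
  have hc₂ : ContinuousOn u₂ s := fun r hr => (h₂ r hr).continuousAt.continuousWithinAt
  have hc₃ : ContinuousOn u₃ s := fun r hr => (h₃ r hr).continuousAt.continuousWithinAt
  have hpow : ContinuousOn (fun r => (1 + u r) ^ p) s :=
    (continuousOn_const.add hc).rpow_const fun r hr => Or.inl (by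
      have := hu r hr
      simp only [Pi.add_apply]
      positivity)
  have d₃ : ContDiffOn ℝ (0 + 1 : ℕ) u₃ s := contDiffOn_succ_of_hasDerivAt hs h₃ <| by
    rw [Nat.cast_zero, contDiffOn_zero]
    exact (((continuousOn_const.mul (continuousOn_id.pow 4)).mul hpow).sub
      (continuousOn_const.mul hc₃)).div continuousOn_id hne
  have d₂ : ContDiffOn ℝ (0 + 1 : ℕ) u₂ s := contDiffOn_succ_of_hasDerivAt hs h₂ <| by
    rw [Nat.cast_zero, contDiffOn_zero]
    exact (hc₃.sub (continuousOn_const.mul hc₂)).div continuousOn_id hne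
  have d₂' : ContDiffOn ℝ (1 + 1 : ℕ) u₂ s := contDiffOn_succ_of_hasDerivAt hs h₂ <|
    (d₃.sub (contDiffOn_const.mul d₂)).div contDiffOn_id hne
  have d₁ : ContDiffOn ℝ (0 + 1 : ℕ) u₁ s := contDiffOn_succ_of_hasDerivAt hs h₁ <| by
    rw [Nat.cast_zero, contDiffOn_zero]
    exact (hc₂.add (continuousOn_const.mul hc₁)).div continuousOn_id hne
  have d₁' : ContDiffOn ℝ (1 + 1 : ℕ) u₁ s := contDiffOn_succ_of_hasDerivAt hs h₁ <|
    (d₂.add (contDiffOn_const.mul d₁)).div contDiffOn_id hne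
  have d₁'' : ContDiffOn ℝ (2 + 1 : ℕ) u₁ s := contDiffOn_succ_of_hasDerivAt hs h₁ <|
    (d₂'.add (contDiffOn_const.mul d₁')).div contDiffOn_id hne
  exact contDiffOn_succ_of_hasDerivAt hs h (d₁''.div contDiffOn_id hne)

lemma radial_bilaplacian_of_system {s : Set ℝ} (hs : IsOpen s) (hs0 : ∀ r ∈ s, 0 < r)
    (h : ∀ r ∈ s, HasDerivAt u (u₁ r / r) r)
    (h₁ : ∀ r ∈ s, HasDerivAt u₁ ((u₂ r + 2 * u₁ r) / r) r)
    (h₂ : ∀ r ∈ s, HasDerivAt u₂ ((u₃ r - (ν - 2) * u₂ r) / r) r)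
    (h₃ : ∀ r ∈ s, HasDerivAt u₃ ((lam * r ^ 4 * (1 + u r) ^ p - (ν - 4) * u₃ r) / r) r) :
    ∀ r ∈ s, deriv^[4] u r + (2 * (ν - 1) / r) * deriv^[3] u r
          + ((ν - 1) * (ν - 3) / r ^ 2) * deriv^[2] u r
          - ((ν - 1) * (ν - 3) / r ^ 3) * deriv u r = lam * (1 + u r) ^ p := by
  have e1 : EqOn (deriv u) (fun r => u₁ r / r) s := fun r hr => (h r hr).deriv
  have e2 : EqOn (deriv^[2] u) (fun r => (u₂ r + u₁ r) / r ^ 2) s := fun r hr => by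
    have hr0 := (hs0 r hr).ne'
    rw [Function.iterate_succ_apply', Function.iterate_one, e1.deriv hs hr]
    refine (((h₁ r hr).div (hasDerivAt_id r) hr0).congr_deriv ?_).deriv
    simp only [id]
    field_simp
    ring
  have e3 : EqOn (deriv^[3] u) (fun r => (u₃ r - (ν - 1) * u₂ r) / r ^ 3) s := fun r hr => by
    have hr0 := (hs0 r hr).ne'
    rw [Function.iterate_succ_apply', e2.deriv hs hr]
    refine ((((h₂ r hr).add (h₁ r hr)).div (hasDerivAt_pow 2 r) (by positivity)).congr_deriv
      ?_).deriv
    simp only [Pi.add_apply]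
    field_simp
    ring
  intro r hr
  have hr0 := (hs0 r hr).ne'
  have e4 : deriv^[4] u r = (lam * r ^ 4 * (1 + u r) ^ p - 2 * (ν - 1) * u₃ r
      + (ν - 1) * (ν + 1) * u₂ r) / r ^ 4 := by
    rw [Function.iterate_succ_apply', e3.deriv hs hr]
    refine ((((h₃ r hr).sub ((h₂ r hr).const_mul (ν - 1))).div (hasDerivAt_pow 3 r)
      (by positivity)).congr_deriv ?_).deriv
    simp only [Pi.sub_apply]
    field_simp
    ring
  rw [e4, e3 hr, e2 hr, e1 hr]
  field_simp
  ring

end System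

/-- for an integer `n > 4` and `p > (n+4)/(n−4)` there exist a
parameter `λ > 0`, a constant `C > 0` and a radial function `u` on `(0,1]`
which is a singular (unbounded near `r = 0`) nonnegative solution of the
Dirichlet problem `Δ²u = λ(1+u)^p` in the unit ball with `u(1) = u'(1) = 0`,
satisfying moreover `u(r) ≤ C r^{−4/(p−1)}`. -/
theorem statement6 (n : ℕ) (hn : 4 < n) (p : ℝ)
    (hp : ((n : ℝ) + 4) / ((n : ℝ) - 4) < p) :
    ∃ (lam C : ℝ) (u : ℝ → ℝ), 0 < lam ∧ 0 < C ∧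
      ContDiffOn ℝ 4 u (Ioo 0 1) ∧ ContDiffOn ℝ 1 u (Ioc 0 1) ∧
      (∀ r ∈ Ioo (0 : ℝ) 1, 0 ≤ u r) ∧
      (∀ r ∈ Ioo (0 : ℝ) 1,
        deriv^[4] u r + (2 * ((n : ℝ) - 1) / r) * deriv^[3] u r
          + (((n : ℝ) - 1) * ((n : ℝ) - 3) / r ^ 2) * deriv^[2] u r
          - (((n : ℝ) - 1) * ((n : ℝ) - 3) / r ^ 3) * deriv u r
        = lam * (1 + u r) ^ p) ∧
      u 1 = 0 ∧ HasDerivWithinAt u 0 (Iic 1) 1 ∧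
      (∀ r ∈ Ioc (0 : ℝ) 1, u r ≤ C * r ^ (-(4 / (p - 1)))) ∧
      (∀ ε : ℝ, 0 < ε → ∀ M : ℝ, ∃ r : ℝ, 0 < r ∧ r < ε ∧ r ≤ 1 ∧ M < u r) := by
  have hν : (4 : ℝ) < n := by exact_mod_cast hn
  have hν4 : (0 : ℝ) < n - 4 := by linarith
  have hp' : (n : ℝ) + 4 < p * (n - 4) := (div_lt_iff₀ hν4).1 hp
  have hp1 : 1 < p := by nlinarith
  have hαν : 4 / (p - 1) < (n : ℝ) - 4 := by
    rw [div_lt_iff₀ (by linarith)]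
    linarith
  obtain ⟨R, A, L, W, W₁, W₂, W₃, hR, hR1, hA, hL, E0, E1, E2, E3, hWR, hanti, hbd⟩ :=
    exists_singular_profile hν hp1 rfl hαν
  have hα : 0 < 4 / (p - 1) := div_pos four_pos (by linarith)
  set α := 4 / (p - 1)
  have hW0 : ∀ r ∈ Ioc 0 R, 0 < W r := fun r hr =>
    (mul_pos hA (Real.rpow_pos_of_pos hr.1 _)).trans_le (hbd r hr).1
  obtain ⟨m, hm⟩ : ∃ m, m = W R := ⟨_, rfl⟩
  have hm0 : 0 < m := hm ▸ hW0 R ⟨hR, le_rfl⟩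
  have hscale1 : ∀ {r : ℝ}, r ∈ Ioc 0 1 → R * r ∈ Ioc 0 R := fun hr =>
    ⟨mul_pos hR hr.1, mul_le_of_le_one_right hR.le hr.2⟩
  have hscale2 : ∀ {r : ℝ}, r ∈ Ioo 0 2 → R * r ∈ Ioo (0 : ℝ) 2 := fun hr =>
    ⟨mul_pos hR hr.1, by nlinarith [hr.1, hr.2]⟩
  have hcomp : ∀ {f : ℝ → ℝ} {f' r : ℝ}, HasDerivAt f (f' / (R * r)) (R * r) →
      HasDerivAt (fun r => f (R * r) / m) ((f' / m) / r) r := fun {f f' r} h => by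
    have h1 : HasDerivAt (fun r => R * r) R r := by simpa using (hasDerivAt_id r).const_mul R
    refine ((h.comp r h1).div_const m).congr_deriv ?_
    field_simp
  set u : ℝ → ℝ := fun r => W (R * r) / m - 1 with hu
  have F0 : ∀ r ∈ Ioo 0 2, HasDerivAt u (W₁ (R * r) / m / r) r := fun r hr =>
    (hcomp (E0 _ (hscale2 hr))).sub_const 1
  have F1 : ∀ r ∈ Ioo 0 2, HasDerivAt (fun r => W₁ (R * r) / m)
      ((W₂ (R * r) / m + 2 * (W₁ (R * r) / m)) / r) r := fun r hr =>
    (hcomp (E1 _ (hscale2 hr))).congr_deriv (by ring)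
  have F2 : ∀ r ∈ Ioo 0 2, HasDerivAt (fun r => W₂ (R * r) / m)
      ((W₃ (R * r) / m - (n - 2) * (W₂ (R * r) / m)) / r) r := fun r hr =>
    (hcomp (E2 _ (hscale2 hr))).congr_deriv (by ring)
  have F3 : ∀ r ∈ Ioo 0 1, HasDerivAt (fun r => W₃ (R * r) / m)
      ((R ^ 4 * m ^ (p - 1) * r ^ 4 * (1 + u r) ^ p - (n - 4) * (W₃ (R * r) / m)) / r) r :=
    fun r hr => by
      have hr' := hscale1 (show r ∈ Ioc 0 1 from ⟨hr.1, hr.2.le⟩)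
      refine (hcomp (E3 _ hr')).congr_deriv ?_
      have : m ^ (p - 1) * (1 + u r) ^ p = W (R * r) ^ p / m := by
        have h0 := hW0 _ hr'
        have h1 : 0 < m ^ p := by positivity
        simp only [hu]
        rw [add_sub_cancel, Real.div_rpow h0.le hm0.le, Real.rpow_sub_one hm0.ne']
        field_simp
      rw [show R ^ 4 * m ^ (p - 1) * r ^ 4 * (1 + u r) ^ p
        = R ^ 4 * r ^ 4 * (m ^ (p - 1) * (1 + u r) ^ p) by ring, this]
      ring
  have hsub : ∀ r ∈ Ioo (0 : ℝ) 1, r ∈ Ioo (0 : ℝ) 2 := fun r hr => ⟨hr.1, by linarith [hr.2]⟩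
  have hu0 : ∀ r ∈ Ioo (0 : ℝ) 1, 0 ≤ u r := fun r hr => by
    have hr' := hscale1 (show r ∈ Ioc 0 1 from ⟨hr.1, hr.2.le⟩)
    rw [hu, sub_nonneg, one_le_div hm0, hm]
    exact hanti hr' ⟨hR, le_rfl⟩ hr'.2
  refine ⟨R ^ 4 * m ^ (p - 1), L * R ^ (-α) / m, u, by positivity, by positivity,
    contDiffOn_four_of_system isOpen_Ioo (fun r hr => hr.1) hu0 (fun r hr => F0 r (hsub r hr))
      (fun r hr => F1 r (hsub r hr)) (fun r hr => F2 r (hsub r hr)) F3, ?_, hu0,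
    radial_bilaplacian_of_system isOpen_Ioo (fun r hr => hr.1) (fun r hr => F0 r (hsub r hr))
      (fun r hr => F1 r (hsub r hr)) (fun r hr => F2 r (hsub r hr)) F3, ?_, ?_, ?_, ?_⟩
  · have : ContDiffOn ℝ (0 + 1 : ℕ) u (Ioo 0 2) :=
      contDiffOn_succ_of_hasDerivAt isOpen_Ioo F0 <| by
        rw [Nat.cast_zero, contDiffOn_zero]
        exact ContinuousOn.div (fun r hr => (F1 r hr).continuousAt.continuousWithinAt)
          continuousOn_id fun r hr => hr.1.ne'
    have h1 : ContDiffOn ℝ 1 u (Ioo 0 2) := by simpa using this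
    exact h1.mono fun r hr => ⟨hr.1, by linarith [hr.2]⟩
  · simp [hu, ← hm, hm0.ne']
  · refine ((F0 1 (by norm_num)).congr_deriv ?_).hasDerivWithinAt
    simp [hWR]
  · intro r hr
    have hr0 := hr.1
    have h1 := (hbd _ (hscale1 hr)).2
    rw [Real.mul_rpow hR.le hr0.le] at h1
    calc u r ≤ W (R * r) / m := by simp [hu]
      _ ≤ L * (R ^ (-α) * r ^ (-α)) / m := by gcongr
      _ = _ := by ring
  · intro ε hε M
    have ht : Tendsto (fun r : ℝ => A * R ^ (-α) / m * r ^ (-α) + -1) (𝓝[>] 0) atTop :=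
      tendsto_atTop_add_const_right _ _
        ((tendsto_rpow_neg_nhdsGT_zero (neg_neg_of_pos hα)).const_mul_atTop (by positivity))
    obtain ⟨r, h1, h2⟩ := ((ht.eventually_gt_atTop M).and
      (Ioo_mem_nhdsGT (lt_min hε one_pos))).exists
    have hr1 : r ≤ 1 := h2.2.le.trans (min_le_right _ _)
    refine ⟨r, h2.1, h2.2.trans_le (min_le_left _ _), hr1, h1.trans_le ?_⟩
    have h3 := (hbd _ (hscale1 (show r ∈ Ioc 0 1 from ⟨h2.1, hr1⟩))).1
    rw [Real.mul_rpow hR.le h2.1.le] at h3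
    calc A * R ^ (-α) / m * r ^ (-α) + -1 = A * (R ^ (-α) * r ^ (-α)) / m - 1 := by ring
      _ ≤ u r := by simp only [hu]; gcongr
end

section
/- Let n > 4 be an integer and p > (n+4)/(n−4). For γ < 0 let U_γ denote the maximal solution of the initial value problem U''''(r) + (2(n−1)/r)U'''(r) + ((n−1)(n−3)/r²)U''(r) − ((n−1)(n−3)/r³)U'(r) = |U(r)|^{p−1}U(r), U(0) = 1, U'(0) = U'''(0) = 0, U''(0) = γ. Assume there is γ̄ < 0 such that: (i) U_γ̄ exists on all of [0,∞), is positive everywhere, satisfies U'_γ̄(r) < 0 for all r > 0, and U_γ̄(r) → 0 as r → ∞; (ii) for each γ ∈ (γ̄, 0) there is a unique R_γ > 0 with U'_γ(r) < 0 on (0, R_γ) and U'_γ(R_γ) = 0, and U_γ(R_γ) > 0; (iii) for γ₁ < γ₂ < 0 one has U_{γ₁} < U_{γ₂} and U'_{γ₁} < U'_{γ₂} as long as both solutions exist; (iv) sup over γ ∈ (γ̄,0) of R_γ⁴·U_γ(R_γ)^{p−1} is finite. Then the map γ ↦ R_γ is strictly monotonically decreasing on (γ̄, 0) and R_γ → +∞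 as γ decreases to γ̄. -/
open Set Filter

lemma abs_rpow_sub_one_mul_self_sub_mem_Icc {p a b : ℝ} (hp : 1 < p) (ha : 0 < a)
    (hab : a ≤ b) (hb : b ≤ 1) :
    |b| ^ (p - 1) * b - |a| ^ (p - 1) * a ∈ Icc 0 (p * (b - a)) := by
  have hb0 : 0 < b := ha.trans_le hab
  have hpow : ∀ x : ℝ, 0 < x → |x| ^ (p - 1) * x = x ^ p := fun x hx => by
    rw [abs_of_pos hx, Real.rpow_sub_one hx.ne']
    field_simp
  rw [hpow a ha, hpow b hb0]
  refine ⟨sub_nonneg.2 (Real.rpow_le_rpow ha.le hab (by linarith)), ?_⟩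
  have hBern := one_add_mul_self_le_rpow_one_add (s := a / b - 1)
    (by linarith [div_pos ha hb0]) hp.le
  rw [add_sub_cancel, Real.div_rpow ha.le hb0.le, le_div_iff₀ (Real.rpow_pos_of_pos hb0 p)]
    at hBern
  have hle : b ^ p ≤ b := by
    simpa using Real.rpow_le_rpow_of_exponent_ge hb0 hb hp.le
  have hprod : (p * (b - a)) * (b ^ p / b) ≤ (p * (b - a)) * 1 :=
    mul_le_mul_of_nonneg_left ((div_le_one hb0).2 hle)
      (mul_nonneg (by linarith) (sub_nonneg.2 hab))
  have hid : (1 + p * (a / b - 1)) * b ^ p = b ^ p - (p * (b - a)) * (b ^ p / b) := by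
    field_simp
    ring
  linarith

/-- A Gronwall estimate for increasing radial solutions of `Δ²w = g` with `0 ≤ g ≤ p w`
in dimension `m + 4`. -/
lemma radial_biharmonic_deriv_le {m : ℕ} {p b δ : ℝ} (hp : 0 ≤ p)
    {w w₁ w₂ w₃ w₄ g : ℝ → ℝ}
    (h₀ : ∀ r ∈ Icc 0 b, HasDerivAt w (w₁ r) r)
    (h₁ : ∀ r ∈ Icc 0 b, HasDerivAt w₁ (w₂ r) r)
    (h₂ : ∀ r ∈ Icc 0 b, HasDerivAt w₂ (w₃ r) r)
    (h₃ : ∀ r ∈ Icc 0 b, HasDerivAt w₃ (w₄ r) r)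
    (hw0 : w 0 = 0) (hw10 : w₁ 0 = 0) (hw20 : w₂ 0 = δ)
    (hw₁ : ∀ r ∈ Ioc 0 b, 0 ≤ w₁ r)
    (hode : ∀ r ∈ Ioc 0 b, w₄ r + (2 * ((m : ℝ) + 3) / r) * w₃ r
      + (((m : ℝ) + 3) * ((m : ℝ) + 1) / r ^ 2) * w₂ r
      - (((m : ℝ) + 3) * ((m : ℝ) + 1) / r ^ 3) * w₁ r = g r)
    (hg : ∀ r ∈ Ioc 0 b, g r ∈ Icc 0 (p * w r)) :
    ∀ r ∈ Ioc 0 b, w₁ r ≤ b * δ * Real.exp (b * (p + 1) * b) := by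
  have hN : (0 : ℝ) < (m : ℝ) + 4 := by positivity
  have hwmono : MonotoneOn w (Icc 0 b) := by
    refine monotoneOn_of_deriv_nonneg (convex_Icc 0 b)
      (fun r hr => (h₀ r hr).continuousAt.continuousWithinAt)
      (fun r hr => (h₀ r (interior_subset hr)).differentiableAt.differentiableWithinAt) ?_
    intro r hr
    rw [(h₀ r (interior_subset hr)).deriv]
    rw [interior_Icc] at hr
    exact hw₁ r ⟨hr.1, hr.2.le⟩
  set A : ℝ → ℝ := fun s =>
    s ^ (m + 3) * w₃ s + ((m : ℝ) + 3) * (s ^ (m + 2) * w₂ s - s ^ (m + 1) * w₁ s) with hA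
  have hAd : ∀ s ∈ Ioc 0 b, HasDerivAt A (s ^ (m + 3) * g s) s := by
    intro s hs
    have hs' : s ∈ Icc 0 b := ⟨hs.1.le, hs.2⟩
    have hs0 : s ≠ 0 := hs.1.ne'
    refine HasDerivAt.congr_deriv (((hasDerivAt_pow (m + 3) s).mul (h₃ s hs')).add
      ((((hasDerivAt_pow (m + 2) s).mul (h₂ s hs')).sub
        ((hasDerivAt_pow (m + 1) s).mul (h₁ s hs'))).const_mul ((m : ℝ) + 3))) ?_
    rw [← hode s hs]
    push_cast
    field_simp
    ring
  have hAc : ∀ s ∈ Icc 0 b, ContinuousAt A s := fun s hs =>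
    ((continuousAt_id.pow _).mul (h₃ s hs).continuousAt).add
      (continuousAt_const.mul
        (((continuousAt_id.pow _).mul (h₂ s hs).continuousAt).sub
          ((continuousAt_id.pow _).mul (h₁ s hs).continuousAt)))
  have hA0 : A 0 = 0 := by simp [hA]
  have hA_nonneg : ∀ r ∈ Ioc 0 b, 0 ≤ A r := by
    intro r hr
    have hmono : MonotoneOn A (Icc 0 b) := by
      refine monotoneOn_of_deriv_nonneg (convex_Icc 0 b)
        (fun s hs => (hAc s hs).continuousWithinAt) ?_ ?_ <;>
      rw [interior_Icc]
      · exact fun s hs => (hAd s ⟨hs.1, hs.2.le⟩).differentiableAt.differentiableWithinAt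
      · intro s hs
        rw [(hAd s ⟨hs.1, hs.2.le⟩).deriv]
        exact mul_nonneg (pow_nonneg hs.1.le _) (hg s ⟨hs.1, hs.2.le⟩).1
    have := hmono ⟨le_rfl, hr.1.le.trans hr.2⟩ ⟨hr.1.le, hr.2⟩ hr.1.le
    rwa [hA0] at this
  have hw_nonneg : ∀ r ∈ Icc 0 b, 0 ≤ w r := by
    intro r hr
    have := hwmono ⟨le_rfl, hr.1.trans hr.2⟩ hr hr.1
    rwa [hw0] at this
  have hcmp : ∀ (r : ℝ), r ∈ Ioc 0 b → ∀ (c : ℝ) (B k : ℝ → ℝ), B 0 = 0 →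
      (∀ s ∈ Icc 0 b, ContinuousAt B s) →
      (∀ s ∈ Ioc 0 b, HasDerivAt B (s ^ (m + 3) * k s) s) →
      (∀ s ∈ Ioo 0 r, k s ≤ c) → B r ≤ r ^ (m + 4) * c / (m + 4) := by
    intro r hr c B k hB0 hBc hBd hk
    have hsub : Icc 0 r ⊆ Icc 0 b := Icc_subset_Icc_right hr.2
    have hd : ∀ s ∈ Ioo 0 r, HasDerivAt (fun s => s ^ (m + 4) * (c / (m + 4)) - B s)
        (s ^ (m + 3) * (c - k s)) s := by
      intro s hs
      refine HasDerivAt.congr_deriv (((hasDerivAt_pow (m + 4) s).mul_const (c / ((m : ℝ) + 4))).sub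
        (hBd s ⟨hs.1, hs.2.le.trans hr.2⟩)) ?_
      push_cast
      field_simp
    have hmono : MonotoneOn (fun s => s ^ (m + 4) * (c / (m + 4)) - B s) (Icc 0 r) := by
      refine monotoneOn_of_deriv_nonneg (convex_Icc 0 r)
        (fun s hs => (((continuousAt_id.pow _).mul continuousAt_const).sub
          (hBc s (hsub hs))).continuousWithinAt) ?_ ?_ <;>
      rw [interior_Icc]
      · exact fun s hs => (hd s hs).differentiableAt.differentiableWithinAt
      · intro s hs
        rw [(hd s hs).deriv]
        exact mul_nonneg (pow_nonneg hs.1.le _) (sub_nonneg.2 (hk s hs))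
    have := hmono ⟨le_rfl, hr.1.le⟩ ⟨hr.1.le, le_rfl⟩ hr.1.le
    simp only [hB0] at this
    rw [zero_pow (by omega), zero_mul, sub_zero, sub_nonneg] at this
    rwa [mul_div_assoc]
  set v : ℝ → ℝ := fun s => w₂ s + ((m : ℝ) + 3) * (w₁ s / s) with hv
  have hvd : ∀ s ∈ Ioc 0 b, HasDerivAt v (A s / s ^ (m + 3)) s := by
    intro s hs
    have hs' : s ∈ Icc 0 b := ⟨hs.1.le, hs.2⟩
    have hs0 : s ≠ 0 := hs.1.ne'
    refine HasDerivAt.congr_deriv ((h₂ s hs').add (((h₁ s hs').div (hasDerivAt_id s) hs0).const_mul ((m : ℝ) + 3))) ?_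
    simp only [hA, id]
    field_simp
    ring
  have hvmono : MonotoneOn v (Ioc 0 b) := by
    refine monotoneOn_of_deriv_nonneg (convex_Ioc 0 b)
      (fun s hs => (hvd s hs).continuousAt.continuousWithinAt)
      (fun s hs => (hvd s (interior_subset hs)).differentiableAt.differentiableWithinAt) ?_
    intro s hs
    rw [(hvd s (interior_subset hs)).deriv]
    exact div_nonneg (hA_nonneg s (interior_subset hs))
      (pow_nonneg (interior_subset hs).1.le _)
  have hw₁v : ∀ r ∈ Ioc 0 b, w₁ r ≤ r * v r / (m + 4) := by
    intro r hr
    have hBr := hcmp r hr (v r) (fun s => s ^ (m + 3) * w₁ s) v (by simp)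
      (fun s hs => (continuousAt_id.pow _).mul (h₁ s hs).continuousAt)
      (fun s hs => by
        have hs0 : s ≠ 0 := hs.1.ne'
        refine HasDerivAt.congr_deriv ((hasDerivAt_pow (m + 3) s).mul (h₁ s ⟨hs.1.le, hs.2⟩)) ?_
        simp only [hv, show m + 3 - 1 = m + 2 from rfl]
        push_cast
        field_simp
        ring)
      (fun s hs => hvmono ⟨hs.1, hs.2.le.trans hr.2⟩ hr hs.2.le)
    refine le_of_mul_le_mul_left (hBr.trans_eq ?_) (pow_pos hr.1 (m + 3))
    ring
  have hv' : ∀ r ∈ Ioc 0 b, A r / r ^ (m + 3) ≤ r * (p * w r) / (m + 4) := by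
    intro r hr
    have hAr := hcmp r hr (p * w r) A g hA0 hAc hAd (fun s hs =>
      (hg s ⟨hs.1, hs.2.le.trans hr.2⟩).2.trans (mul_le_mul_of_nonneg_left
        (hwmono ⟨hs.1.le, hs.2.le.trans hr.2⟩ ⟨hr.1.le, hr.2⟩ hs.2.le) hp))
    rw [div_le_iff₀ (pow_pos hr.1 _)]
    refine hAr.trans_eq ?_
    ring
  have hv_nonneg : ∀ r ∈ Ioc 0 b, 0 ≤ v r := by
    intro r hr
    have h := (hw₁ r hr).trans (hw₁v r hr)
    rw [le_div_iff₀ hN, zero_mul] at h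
    exact nonneg_of_mul_nonneg_right h hr.1
  have hEd : ∀ s ∈ Ioc 0 b, HasDerivAt (fun s => (w s + v s) * Real.exp (-(b * (p + 1)) * s))
      ((w₁ s + A s / s ^ (m + 3) - b * (p + 1) * (w s + v s))
        * Real.exp (-(b * (p + 1)) * s)) s := by
    intro s hs
    refine HasDerivAt.congr_deriv (((h₀ s ⟨hs.1.le, hs.2⟩).add (hvd s hs)).mul
      (((hasDerivAt_id s).const_mul (-(b * (p + 1)))).exp)) ?_
    simp only [id, Pi.add_apply]
    ring
  have hEanti : AntitoneOn (fun s => (w s + v s) * Real.exp (-(b * (p + 1)) * s))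
      (Ioc 0 b) := by
    refine antitoneOn_of_deriv_nonpos (convex_Ioc 0 b)
      (fun s hs => (hEd s hs).continuousAt.continuousWithinAt)
      (fun s hs => (hEd s (interior_subset hs)).differentiableAt.differentiableWithinAt) ?_
    intro s hs
    replace hs := interior_subset hs
    rw [(hEd s hs).deriv]
    refine mul_nonpos_of_nonpos_of_nonneg ?_ (Real.exp_pos _).le
    have hws := hw_nonneg s ⟨hs.1.le, hs.2⟩
    have hvs := hv_nonneg s hs
    have hdiv : ∀ x : ℝ, 0 ≤ x → s * x / ((m : ℝ) + 4) ≤ b * x := fun x hx =>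
      (div_le_self (mul_nonneg hs.1.le hx) (by linarith [(Nat.cast_nonneg m : (0 : ℝ) ≤ m)])).trans
        (mul_le_mul_of_nonneg_right hs.2 hx)
    have e1 := (hw₁v s hs).trans (hdiv _ hvs)
    have e2 := (hv' s hs).trans (hdiv _ (mul_nonneg hp hws))
    have hb : 0 ≤ b := hs.1.le.trans hs.2
    have e3 : 0 ≤ b * p * v s := by positivity
    have e4 : 0 ≤ b * w s := by positivity
    linarith
  intro r hr
  have hb : 0 < b := hr.1.trans_le hr.2
  have h0b : (0 : ℝ) ∈ Icc 0 b := ⟨le_rfl, hb.le⟩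
  have hlim : Tendsto (fun s => (w s + v s) * Real.exp (-(b * (p + 1)) * s))
      (nhdsWithin 0 (Ioi 0)) (nhds ((0 + (δ + ((m : ℝ) + 3) * δ)) * 1)) := by
    have hslope : Tendsto (fun s => w₁ s / s) (nhdsWithin 0 (Ioi 0)) (nhds δ) := by
      have h := (hasDerivAt_iff_tendsto_slope.1 (h₁ 0 h0b)).mono_left
        (nhdsWithin_mono 0 (fun x (hx : 0 < x) => hx.ne'))
      rw [hw20] at h
      refine h.congr fun s => ?_
      simp [slope_def_field, hw10]
    have hw' : Tendsto w (nhdsWithin 0 (Ioi 0)) (nhds 0) := by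
      simpa [hw0] using (h₀ 0 h0b).continuousAt.tendsto.mono_left nhdsWithin_le_nhds
    have hw₂' : Tendsto w₂ (nhdsWithin 0 (Ioi 0)) (nhds δ) := by
      simpa [hw20] using (h₂ 0 h0b).continuousAt.tendsto.mono_left nhdsWithin_le_nhds
    have hexp : Tendsto (fun s => Real.exp (-(b * (p + 1)) * s)) (nhdsWithin 0 (Ioi 0))
        (nhds 1) := by
      have hc : Continuous fun s : ℝ => Real.exp (-(b * (p + 1)) * s) := by fun_prop
      simpa using (hc.tendsto 0).mono_left nhdsWithin_le_nhds
    exact (hw'.add (hw₂'.add (hslope.const_mul _))).mul hexp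
  have hEr : (w r + v r) * Real.exp (-(b * (p + 1)) * r) ≤
      (0 + (δ + ((m : ℝ) + 3) * δ)) * 1 := by
    refine ge_of_tendsto hlim ?_
    filter_upwards [Ioc_mem_nhdsGT hr.1] with s hs
    exact hEanti ⟨hs.1, hs.2.trans hr.2⟩ hr hs.2
  have hvr : v r ≤ (m + 4) * δ * Real.exp (b * (p + 1) * r) := by
    have hmul := mul_le_mul_of_nonneg_right hEr (Real.exp_pos (b * (p + 1) * r)).le
    rw [mul_assoc, ← Real.exp_add] at hmul
    rw [show -(b * (p + 1)) * r + b * (p + 1) * r = 0 by ring, Real.exp_zero] at hmul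
    have := hw_nonneg r ⟨hr.1.le, hr.2⟩
    linarith
  have hδ : 0 ≤ δ := by
    have := (hv_nonneg r hr).trans hvr
    have h := nonneg_of_mul_nonneg_left this (Real.exp_pos _)
    exact nonneg_of_mul_nonneg_right h hN
  calc w₁ r ≤ r * v r / (m + 4) := hw₁v r hr
    _ ≤ r * ((m + 4) * δ * Real.exp (b * (p + 1) * r)) / (m + 4) := by
      have := hr.1.le
      gcongr
    _ = r * δ * Real.exp (b * (p + 1) * r) := by field_simp
    _ ≤ b * δ * Real.exp (b * (p + 1) * b) := by
      have := hr.2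
      gcongr

lemma ContDiffAt.hasDerivAt_iterate_deriv {f : ℝ → ℝ} {r : ℝ} {k : ℕ}
    (hf : ContDiffAt ℝ 4 f r) (hk : k < 4) :
    HasDerivAt (deriv^[k] f) (deriv^[k + 1] f r) r := by
  rw [Function.iterate_succ_apply', ← iteratedDeriv_eq_iterate]
  refine DifferentiableAt.hasDerivAt ?_
  rw [iteratedDeriv_eq_equiv_comp, LinearIsometryEquiv.comp_differentiableAt_iff]
  exact hf.differentiableAt_iteratedFDeriv (by exact_mod_cast hk)

/-- shooting for `Δ²U = |U|^{p−1}U`, `U(0)=1`, `U'(0)=U'''(0)=0`,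
`U''(0)=γ<0`.  `U γ` is the (maximal) solution, defined on `[0, T γ)`.
Under the Gazzola–Grunau hypotheses (i)–(iii) and the boundedness hypothesis
(iv), the map `γ ↦ R_γ` (the first critical radius, for `γ ∈ (γ̄,0)`) is
strictly decreasing and `R_γ → +∞` as `γ ↓ γ̄`. -/
theorem statement8 (n : ℕ) (hn : 4 < n) (p : ℝ)
    (hp : ((n : ℝ) + 4) / ((n : ℝ) - 4) < p)
    (U : ℝ → ℝ → ℝ) (T : ℝ → EReal) (R : ℝ → ℝ) (γbar : ℝ) (hγbar : γbar < 0)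
    -- `U γ` solves the initial value problem on `[0, T γ)`
    (hTpos : ∀ γ : ℝ, γ < 0 → (0 : EReal) < T γ)
    (hsmooth : ∀ γ : ℝ, γ < 0 → ∀ r : ℝ, 0 ≤ r → (r : EReal) < T γ →
      ContDiffAt ℝ 4 (U γ) r)
    (hinit : ∀ γ : ℝ, γ < 0 → U γ 0 = 1 ∧ deriv (U γ) 0 = 0 ∧
      deriv^[3] (U γ) 0 = 0 ∧ deriv^[2] (U γ) 0 = γ)
    (hODE : ∀ γ : ℝ, γ < 0 → ∀ r : ℝ, 0 < r → (r : EReal) < T γ →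
      deriv^[4] (U γ) r + (2 * ((n : ℝ) - 1) / r) * deriv^[3] (U γ) r
        + (((n : ℝ) - 1) * ((n : ℝ) - 3) / r ^ 2) * deriv^[2] (U γ) r
        - (((n : ℝ) - 1) * ((n : ℝ) - 3) / r ^ 3) * deriv (U γ) r
      = |U γ r| ^ (p - 1) * U γ r)
    -- (i): the solution at `γ̄` is global, positive, strictly decreasing and
    -- vanishes at infinity
    (hi : T γbar = ⊤ ∧ (∀ r : ℝ, 0 ≤ r → 0 < U γbar r) ∧
      (∀ r : ℝ, 0 < r → deriv (U γbar) r < 0) ∧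
      Tendsto (U γbar) atTop (nhds 0))
    -- (ii): for `γ ∈ (γ̄, 0)`, `R γ` is the unique critical radius
    (hii : ∀ γ ∈ Ioo γbar 0, 0 < R γ ∧ (R γ : EReal) < T γ ∧
      (∀ r ∈ Ioo 0 (R γ), deriv (U γ) r < 0) ∧ deriv (U γ) (R γ) = 0 ∧
      0 < U γ (R γ) ∧
      (∀ r : ℝ, 0 < r → (r : EReal) < T γ → deriv (U γ) r = 0 → r = R γ))
    -- (iii): monotone dependence on the initial datum, as long as both
    -- solutions exist
    (hiii : ∀ γ₁ γ₂ : ℝ, γ₁ < γ₂ → γ₂ < 0 → γbar ≤ γ₁ →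
      ∀ r : ℝ, 0 < r → (r : EReal) < T γ₁ → (r : EReal) < T γ₂ →
        U γ₁ r < U γ₂ r ∧ deriv (U γ₁) r < deriv (U γ₂) r)
    -- (iv): `R_γ⁴ · U_γ(R_γ)^{p−1}` is uniformly bounded
    (hiv : ∃ C : ℝ, ∀ γ ∈ Ioo γbar 0, R γ ^ 4 * U γ (R γ) ^ (p - 1) ≤ C) :
    StrictAntiOn R (Ioo γbar 0) ∧
    Tendsto R (nhdsWithin γbar (Ioi γbar)) atTop := by
  have hanti : StrictAntiOn R (Ioo γbar 0) := by
    intro γ₁ hγ₁ γ₂ hγ₂ hlt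
    by_contra! hle
    obtain ⟨hpos₁, hT₁, -, hcrit₁, -, -⟩ := hii γ₁ hγ₁
    obtain ⟨-, hT₂, hneg₂, hcrit₂, -, -⟩ := hii γ₂ hγ₂
    have h := (hiii γ₁ γ₂ hlt hγ₂.2 hγ₁.1.le (R γ₁) hpos₁ hT₁
      ((EReal.coe_le_coe_iff.2 hle).trans_lt hT₂)).2
    rw [hcrit₁] at h
    rcases hle.eq_or_lt with heq | hlt'
    · rw [heq, hcrit₂] at h
      exact h.false
    · exact h.not_gt (hneg₂ _ ⟨hpos₁, hlt'⟩)
  refine ⟨hanti, tendsto_atTop.2 fun M => ?_⟩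
  suffices hex : ∃ γ₀ ∈ Ioo γbar 0, M ≤ R γ₀ by
    obtain ⟨γ₀, hγ₀, hM⟩ := hex
    filter_upwards [Ioc_mem_nhdsGT hγ₀.1] with γ hγ
    exact hM.trans (hanti.antitoneOn ⟨hγ.1, hγ.2.trans_lt hγ₀.2⟩ hγ₀ hγ.2)
  by_contra! hbdd
  have hp1 : 1 < p := by
    have hn' : (4 : ℝ) < n := by exact_mod_cast hn
    refine lt_trans ?_ hp
    rw [lt_div_iff₀ (by linarith)]
    linarith
  have hTbar : ∀ r : ℝ, (r : EReal) < T γbar := fun r => hi.1 ▸ EReal.coe_lt_top r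
  have hdiff_le : ∀ γ ∈ Ioo γbar 0, deriv (U γ) (R γ) - deriv (U γbar) (R γ) ≤
      M * (γ - γbar) * Real.exp (M * (p + 1) * M) := by
    intro γ hγ
    obtain ⟨hRpos, hRT, hneg, -, -, -⟩ := hii γ hγ
    have hT : ∀ r ≤ R γ, (r : EReal) < T γ := fun r hr =>
      (EReal.coe_le_coe_iff.2 hr).trans_lt hRT
    have hU : ∀ k < 4, ∀ r ∈ Icc 0 (R γ),
        HasDerivAt (deriv^[k] (U γ)) (deriv^[k + 1] (U γ) r) r := fun k hk r hr =>
      (hsmooth γ hγ.2 r hr.1 (hT r hr.2)).hasDerivAt_iterate_deriv hk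
    have hUbar : ∀ k < 4, ∀ r ∈ Icc 0 (R γ),
        HasDerivAt (deriv^[k] (U γbar)) (deriv^[k + 1] (U γbar) r) r := fun k hk r hr =>
      (hsmooth γbar hγbar r hr.1 (hTbar r)).hasDerivAt_iterate_deriv hk
    have hw : ∀ k < 4, ∀ r ∈ Icc 0 (R γ),
        HasDerivAt (fun s => deriv^[k] (U γ) s - deriv^[k] (U γbar) s)
          (deriv^[k + 1] (U γ) r - deriv^[k + 1] (U γbar) r) r := fun k hk r hr =>
      (hU k hk r hr).sub (hUbar k hk r hr)
    have hle_one : ∀ r ∈ Icc 0 (R γ), U γ r ≤ 1 := by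
      have hUanti : AntitoneOn (U γ) (Icc 0 (R γ)) := by
        refine antitoneOn_of_deriv_nonpos (convex_Icc _ _)
          (fun r hr => (hU 0 (by norm_num) r hr).continuousAt.continuousWithinAt)
          (fun r hr => (hU 0 (by norm_num) r
            (interior_subset hr)).differentiableAt.differentiableWithinAt) ?_
        rw [interior_Icc]
        exact fun r hr => (hneg r hr).le
      intro r hr
      have h := hUanti ⟨le_rfl, hRpos.le⟩ hr hr.1
      rwa [(hinit γ hγ.2).1] at h
    have hcmp := fun r (hr : r ∈ Ioc 0 (R γ)) =>
      hiii γbar γ hγ.1 hγ.2 le_rfl r hr.1 (hTbar r) (hT r hr.2)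
    obtain ⟨hi0, hi1, -, hi2⟩ := hinit γ hγ.2
    obtain ⟨hj0, hj1, -, hj2⟩ := hinit γbar hγbar
    obtain ⟨m, rfl⟩ : ∃ m, n = m + 4 := ⟨n - 4, by omega⟩
    have hgron := radial_biharmonic_deriv_le (m := m) (p := p) (b := R γ) (δ := γ - γbar)
      (g := fun r => |U γ r| ^ (p - 1) * U γ r - |U γbar r| ^ (p - 1) * U γbar r)
      (by linarith) (hw 0 (by norm_num)) (hw 1 (by norm_num)) (hw 2 (by norm_num))
      (hw 3 (by norm_num)) (sub_eq_zero.2 (hi0.trans hj0.symm))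
      (sub_eq_zero.2 (hi1.trans hj1.symm)) (congrArg₂ (· - ·) hi2 hj2)
      (fun r hr => sub_nonneg.2 (hcmp r hr).2.le)
      (fun r hr => by
        rw [← hODE γ hγ.2 r hr.1 (hT r hr.2), ← hODE γbar hγbar r hr.1 (hTbar r)]
        simp only [Function.iterate_succ, Function.iterate_zero, Function.comp, id]
        push_cast
        ring)
      (fun r hr => abs_rpow_sub_one_mul_self_sub_mem_Icc hp1 (hi.2.1 r hr.1.le)
        (hcmp r hr).1.le (hle_one r ⟨hr.1.le, hr.2⟩))
      (R γ) ⟨hRpos, le_rfl⟩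
    refine hgron.trans ?_
    have hRM := (hbdd γ hγ).le
    have hγ' : 0 ≤ γ - γbar := sub_nonneg.2 hγ.1.le
    have hM : 0 ≤ M := hRpos.le.trans hRM
    gcongr
  obtain ⟨γ₀, hγ₀⟩ : (Ioo γbar 0).Nonempty := nonempty_Ioo.2 hγbar
  have hR₀ : 0 < R γ₀ := (hii γ₀ hγ₀).1
  have hcont : ContinuousOn (deriv (U γbar)) (Icc (R γ₀) M) := fun r hr =>
    ((hsmooth γbar hγbar r (hR₀.le.trans hr.1) (hTbar r)).hasDerivAt_iterate_deriv
      (k := 1) (by norm_num)).continuousAt.continuousWithinAt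
  obtain ⟨x, hx, hmax⟩ := isCompact_Icc.exists_isMaxOn
    (nonempty_Icc.2 (hbdd γ₀ hγ₀).le) hcont
  have hxneg : deriv (U γbar) x < 0 := hi.2.2.1 x (hR₀.trans_le hx.1)
  have hlim : Tendsto (fun γ => M * (γ - γbar) * Real.exp (M * (p + 1) * M))
      (nhdsWithin γbar (Ioi γbar)) (nhds 0) := by
    have hc : Continuous fun γ => M * (γ - γbar) * Real.exp (M * (p + 1) * M) := by fun_prop
    simpa using (hc.tendsto γbar).mono_left nhdsWithin_le_nhds
  obtain ⟨γ, hsmall, hγ⟩ := ((hlim.eventually_lt_const (neg_pos.2 hxneg)).and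
    (Ioc_mem_nhdsGT hγ₀.1)).exists
  have hγ' : γ ∈ Ioo γbar 0 := ⟨hγ.1, hγ.2.trans_lt hγ₀.2⟩
  have hle := hdiff_le γ hγ'
  rw [(hii γ hγ').2.2.2.1] at hle
  have hmax' : deriv (U γbar) (R γ) ≤ deriv (U γbar) x :=
    hmax ⟨hanti.antitoneOn hγ' hγ₀ hγ.2, (hbdd γ hγ').le⟩
  linarith
end

section
/- Let n be an integer with 5 ≤ n ≤ 12 and let p > (n+4)/(n−4). Set K₀ = (4/(p−1))·(4/(p−1)+2)·(n−2−4/(p−1))·(n−4−4/(p−1)). Then p·K₀ > n²(n−4)²/16. -/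
/-- for an integer `5 ≤ n ≤ 12` and `p > (n+4)/(n−4)`, the constant
`K₀ = (4/(p−1))(4/(p−1)+2)(n−2−4/(p−1))(n−4−4/(p−1))` satisfies
`p·K₀ > n²(n−4)²/16`. -/
theorem statement9 (n : ℕ) (hn5 : 5 ≤ n) (hn12 : n ≤ 12) (p : ℝ)
    (hp : ((n : ℝ) + 4) / ((n : ℝ) - 4) < p)
    (K₀ : ℝ)
    (hK0 : K₀ = (4 / (p - 1)) * (4 / (p - 1) + 2) * ((n : ℝ) - 2 - 4 / (p - 1))
      * ((n : ℝ) - 4 - 4 / (p - 1))) :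
    (n : ℝ) ^ 2 * ((n : ℝ) - 4) ^ 2 / 16 < p * K₀ := by
  have hn5' : (5 : ℝ) ≤ n := by exact_mod_cast hn5
  have hn12' : (n : ℝ) ≤ 12 := by exact_mod_cast hn12
  have hpoly : (n : ℝ) ^ 2 * ((n : ℝ) - 4) ^ 2 / 16
      < (((n : ℝ) ^ 2 - 16) / 4) * (2 * ((n : ℝ) - 2)) := by
    interval_cases n <;> norm_num
  generalize (n : ℝ) = x at *
  have hx : 0 < x - 4 := by linarith
  have hp1 : 8 < (p - 1) * (x - 4) := by
    rw [div_lt_iff₀ hx] at hp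
    linarith
  have hp0 : 0 < p - 1 := pos_of_mul_pos_left (by linarith) hx.le
  obtain ⟨m, hm⟩ : ∃ m, m = 4 / (p - 1) := ⟨_, rfl⟩
  have hm0 : 0 < m := hm ▸ by positivity
  have hm1 : m < (x - 4) / 2 := by
    rw [hm, div_lt_iff₀ hp0]
    linarith
  have hpm : p * m = m + 4 := by
    have : m * (p - 1) = 4 := by rw [hm]; field_simp
    linarith
  rw [← hm] at hK0
  have hpK : p * K₀ = ((m + 4) * (x - 4 - m)) * ((m + 2) * (x - 2 - m)) := by
    rw [hK0, ← hpm]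
    ring
  have hA : (x ^ 2 - 16) / 4 ≤ (m + 4) * (x - 4 - m) := by
    have : 0 ≤ ((x - 4) / 2 - m) * (m + (12 - x) / 2) :=
      mul_nonneg (by linarith) (by linarith)
    linarith
  have hB : 2 * (x - 2) ≤ (m + 2) * (x - 2 - m) := by
    have : 0 ≤ m * (x - 4 - m) := mul_nonneg hm0.le (by linarith)
    linarith
  rw [hpK]
  exact hpoly.trans_le (mul_le_mul hA hB (by linarith)
    (mul_nonneg (by linarith) (by linarith)))
end

section
/- Let n ≥ 13 be an integer. For q > 1 set g(q) = q·(4/(q−1))·(4/(q−1)+2)·(n−2−4/(q−1))·(n−4−4/(q−1)). Suppose p_c ∈ ((n+4)/(n−4), ∞) is the unique number in that interval satisfying g(p_c) = n²(n−4)²/16. Then for every p with (n+4)/(n−4) < p < p_c one has g(p) > n²(n−4)²/16; equivalently, p·K₀ > n²(n−4)²/16 where K₀ = (4/(p−1))·(4/(p−1)+2)·(n−2−4/(p−1))·(n−4−4/(p−1)). -/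
/-- for an integer `n ≥ 13`, let
`g(q) = q·(4/(q−1))·(4/(q−1)+2)·(n−2−4/(q−1))·(n−4−4/(q−1))` and let `p_c` be the
unique number in `((n+4)/(n−4), ∞)` with `g(p_c) = n²(n−4)²/16`.  Then for every
`p` with `(n+4)/(n−4) < p < p_c` one has `g(p) > n²(n−4)²/16`, i.e.
`p·K₀ > n²(n−4)²/16`. -/
theorem statement10 (n : ℕ) (hn : 13 ≤ n) (g : ℝ → ℝ)
    (hg : ∀ q : ℝ, g q = q * (4 / (q - 1)) * (4 / (q - 1) + 2)
      * ((n : ℝ) - 2 - 4 / (q - 1)) * ((n : ℝ) - 4 - 4 / (q - 1)))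
    (pc : ℝ)
    (hpc₁ : ((n : ℝ) + 4) / ((n : ℝ) - 4) < pc)
    (hpc₂ : g pc = (n : ℝ) ^ 2 * ((n : ℝ) - 4) ^ 2 / 16)
    (hpc₃ : ∀ q : ℝ, ((n : ℝ) + 4) / ((n : ℝ) - 4) < q →
      g q = (n : ℝ) ^ 2 * ((n : ℝ) - 4) ^ 2 / 16 → q = pc)
    (p : ℝ) (hp₁ : ((n : ℝ) + 4) / ((n : ℝ) - 4) < p) (hp₂ : p < pc) :
    (n : ℝ) ^ 2 * ((n : ℝ) - 4) ^ 2 / 16 < g p ∧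
    (n : ℝ) ^ 2 * ((n : ℝ) - 4) ^ 2 / 16
      < p * ((4 / (p - 1)) * (4 / (p - 1) + 2) * ((n : ℝ) - 2 - 4 / (p - 1))
        * ((n : ℝ) - 4 - 4 / (p - 1))) := by
  have hn' : (13 : ℝ) ≤ n := by exact_mod_cast hn
  have hn4 : (0 : ℝ) < (n : ℝ) - 4 := by linarith
  set q₀ : ℝ := ((n : ℝ) + 4) / ((n : ℝ) - 4) with hq₀
  have hq₀1 : 1 < q₀ := by rw [hq₀, one_lt_div hn4]; linarith
  have hexp : 4 / (q₀ - 1) = ((n : ℝ) - 4) / 2 := by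
    have h8 : q₀ - 1 = 8 / ((n : ℝ) - 4) := by
      rw [hq₀]
      field_simp
      ring
    rw [h8]
    field_simp
    norm_num
  -- at the Sobolev exponent, `g` equals `q₀` times the Hardy–Rellich constant
  have hstart : (n : ℝ) ^ 2 * ((n : ℝ) - 4) ^ 2 / 16 < g q₀ := by
    have heq : g q₀ = q₀ * ((n : ℝ) ^ 2 * ((n : ℝ) - 4) ^ 2 / 16) := by
      rw [hg, hexp]
      ring
    rw [heq]
    have hpos : 0 < (n : ℝ) ^ 2 * ((n : ℝ) - 4) ^ 2 / 16 := by positivity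
    exact lt_mul_of_one_lt_left hpos hq₀1
  have hcont : ContinuousOn g (Set.Icc q₀ p) := by
    rw [funext hg]
    have hdiv : ContinuousOn (fun q : ℝ => 4 / (q - 1)) (Set.Icc q₀ p) :=
      continuousOn_const.div (by fun_prop) fun q hq => by linarith [hq.1]
    fun_prop
  have hmain : (n : ℝ) ^ 2 * ((n : ℝ) - 4) ^ 2 / 16 < g p := by
    by_contra! hle
    obtain ⟨q, ⟨hq, hqp⟩, hgq⟩ := intermediate_value_Icc' hp₁.le hcont ⟨hle, hstart.le⟩
    have hne : q₀ ≠ q := by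
      rintro h
      rw [h, hgq] at hstart
      exact lt_irrefl _ hstart
    exact absurd (hpc₃ q (lt_of_le_of_ne hq hne) hgq) (hqp.trans_lt hp₂).ne
  refine ⟨hmain, ?_⟩
  rw [hg] at hmain
  simpa only [mul_assoc] using hmain
end

section
/- Let n ≥ 5 be an integer and p > (n+4)/(n−4). Define K₀ = (4/(p−1))·(4/(p−1)+2)·(n−2−4/(p−1))·(n−4−4/(p−1)), N₁ = −(n−4)(p−1)+8, N₂ = (n²−4n+8)(p−1)², N₃ = (9n−34)(n−2)(p−1)⁴ + 8(3n−8)(n−6)(p−1)³ + (16n²−288n+832)(p−1)² − 128(n−6)(p−1) + 256, and the polynomial P(ν) = (ν − 4/(p−1) + n − 4)(ν − 4/(p−1) + n − 2)(ν − 4/(p−1) − 2)(ν − 4/(p−1)) − p·K₀. Set ν₁ = (N₁ + √(N₂ + 4√N₃))/(2(p−1)) and ν₂ = (N₁ − √(N₂ + 4√N₃))/(2(p−1)). Then N₃ > 0 and N₂ + 4√N₃ > 0, the numbers ν₁ and ν₂ are real roots of P, and ν₂ < 0 < ν₁. -/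
/-- If `s ^ 2 = N₂ + 4 t` and `t ^ 2 = N₃`, with `q = p - 1`, then `(N₁ + s) / (2 q)` is a root of
the characteristic polynomial. -/
lemma charpoly_eq_zero_of_sq_eq {m q s t : ℝ} (hq : q ≠ 0)
    (hs : s ^ 2 = (m ^ 2 - 4 * m + 8) * q ^ 2 + 4 * t)
    (ht : t ^ 2 = (m - 2) ^ 2 * q ^ 4
      + 8 * (q + 1) * (q + 2) * ((m - 2) * q - 4) * ((m - 4) * q - 4)) :
    ((-(m - 4) * q + 8 + s) / (2 * q) - 4 / q + m - 4)
      * ((-(m - 4) * q + 8 + s) / (2 * q) - 4 / q + m - 2)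
      * ((-(m - 4) * q + 8 + s) / (2 * q) - 4 / q - 2)
      * ((-(m - 4) * q + 8 + s) / (2 * q) - 4 / q)
      - (q + 1) * ((4 / q) * (4 / q + 2) * (m - 2 - 4 / q) * (m - 4 - 4 / q)) = 0 := by
  have h₁ : (-(m - 4) * q + 8 + s) / (2 * q) - 4 / q = (s - (m - 4) * q) / (2 * q) := by
    field_simp
    ring
  have h₂ : (s ^ 2 - (m - 4) ^ 2 * q ^ 2) * (s ^ 2 - m ^ 2 * q ^ 2)
      = 128 * (q + 1) * (q + 2) * ((m - 2) * q - 4) * ((m - 4) * q - 4) := by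
    rw [hs]
    linear_combination 16 * ht
  rw [h₁]
  field_simp
  linear_combination h₂

/-- for an integer `n ≥ 5` and `p > (n+4)/(n−4)`, the quantities
`N₃` and `N₂ + 4√N₃` are positive, and the numbers
`ν₁ = (N₁ + √(N₂+4√N₃))/(2(p−1))`, `ν₂ = (N₁ − √(N₂+4√N₃))/(2(p−1))` are real
roots of the characteristic polynomial
`P(ν) = (ν−4/(p−1)+n−4)(ν−4/(p−1)+n−2)(ν−4/(p−1)−2)(ν−4/(p−1)) − p·K₀`,
with `ν₂ < 0 < ν₁`. -/
theorem statement13 (n : ℕ) (hn : 5 ≤ n) (p : ℝ)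
    (hp : ((n : ℝ) + 4) / ((n : ℝ) - 4) < p)
    (K₀ N₁ N₂ N₃ : ℝ) (P : ℝ → ℝ) (ν₁ ν₂ : ℝ)
    (hK0 : K₀ = (4 / (p - 1)) * (4 / (p - 1) + 2) * ((n : ℝ) - 2 - 4 / (p - 1))
      * ((n : ℝ) - 4 - 4 / (p - 1)))
    (hN1 : N₁ = -((n : ℝ) - 4) * (p - 1) + 8)
    (hN2 : N₂ = ((n : ℝ) ^ 2 - 4 * (n : ℝ) + 8) * (p - 1) ^ 2)
    (hN3 : N₃ = (9 * (n : ℝ) - 34) * ((n : ℝ) - 2) * (p - 1) ^ 4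
      + 8 * (3 * (n : ℝ) - 8) * ((n : ℝ) - 6) * (p - 1) ^ 3
      + (16 * (n : ℝ) ^ 2 - 288 * (n : ℝ) + 832) * (p - 1) ^ 2
      - 128 * ((n : ℝ) - 6) * (p - 1) + 256)
    (hP : ∀ ν : ℝ, P ν = (ν - 4 / (p - 1) + (n : ℝ) - 4)
      * (ν - 4 / (p - 1) + (n : ℝ) - 2) * (ν - 4 / (p - 1) - 2)
      * (ν - 4 / (p - 1)) - p * K₀)
    (hν1 : ν₁ = (N₁ + Real.sqrt (N₂ + 4 * Real.sqrt N₃)) / (2 * (p - 1)))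
    (hν2 : ν₂ = (N₁ - Real.sqrt (N₂ + 4 * Real.sqrt N₃)) / (2 * (p - 1))) :
    0 < N₃ ∧ 0 < N₂ + 4 * Real.sqrt N₃ ∧
    P ν₁ = 0 ∧ P ν₂ = 0 ∧ ν₂ < 0 ∧ 0 < ν₁ := by
  have hn' : (5 : ℝ) ≤ n := by exact_mod_cast hn
  generalize (n : ℝ) = m at *
  obtain ⟨q, rfl⟩ : ∃ q, p = q + 1 := ⟨p - 1, by ring⟩
  simp only [add_sub_cancel_right] at *
  have hmq : 8 < (m - 4) * q := by
    rw [div_lt_iff₀ (by linarith)] at hp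
    linarith
  have hq : 0 < q := pos_of_mul_pos_right (by linarith) (by linarith : 0 ≤ m - 4)
  have hN3' : N₃ = (m - 2) ^ 2 * q ^ 4
      + 8 * (q + 1) * (q + 2) * ((m - 2) * q - 4) * ((m - 4) * q - 4) := by
    rw [hN3]
    ring
  have hN3_pos : 0 < N₃ := by
    have h₁ : 0 < (m - 2) * q - 4 := by linarith
    have h₂ : 0 < (m - 4) * q - 4 := by linarith
    have h₃ : 0 < m - 2 := by linarith
    rw [hN3']
    positivity
  have hN1_sq : N₁ ^ 2 < N₂ + 4 * √N₃ := by
    have h₁ : 0 < (m - 2) * q ^ 2 := mul_pos (by linarith) (by positivity)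
    have h₂ : 0 ≤ √N₃ := Real.sqrt_nonneg _
    rw [hN1, hN2]
    nlinarith
  have hpos : 0 < N₂ + 4 * √N₃ := (sq_nonneg N₁).trans_lt hN1_sq
  have hN1_abs : |N₁| < √(N₂ + 4 * √N₃) := Real.lt_sqrt_of_sq_lt (by rwa [sq_abs])
  have hsq : √(N₂ + 4 * √N₃) ^ 2 = (m ^ 2 - 4 * m + 8) * q ^ 2 + 4 * √N₃ := by
    rw [Real.sq_sqrt hpos.le, hN2]
  have ht := (Real.sq_sqrt hN3_pos.le).trans hN3'
  refine ⟨hN3_pos, hpos, ?_, ?_, ?_, ?_⟩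
  · rw [hP, hν1, hN1, hK0]
    exact charpoly_eq_zero_of_sq_eq hq.ne' hsq ht
  · rw [hP, hν2, hN1, hK0, sub_eq_add_neg (-(m - 4) * q + 8)]
    exact charpoly_eq_zero_of_sq_eq hq.ne' ((neg_sq _).trans hsq) ht
  · rw [hν2]
    exact div_neg_of_neg_of_pos (by linarith [le_abs_self N₁]) (by positivity)
  · rw [hν1]
    exact div_pos (by linarith [neg_abs_le N₁]) (by positivity)
end
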